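/- arXiv:1903.07816 — 6 statements merged into one kernel-verified Lean document; each statement's English description precedes it below -/
import Mathlib

section
/- For every α ∈ (0,1): b_k^{(α)} > 0 for every integer k ≥ 1, the sequence b_k^{(α)} tends to 0 as k → ∞, and b_k^{(α)} > b_{k+1}^{(α)} for every integer k ≥ 1. -/
/-- `b`-coefficients for `α ∈ (0,1)`, `k ≥ 1`. -/
noncomputable def bC (α : ℝ) (k : ℕ) : ℝ :=
  (1 / (2 - α)) * (((k : ℝ) + 1 / 2) ^ (2 - α) - ((k : ℝ) - 1 / 2) ^ (2 - α))
    - (1 / 2) * (((k : ℝ) + 1 / 2) ^ (1 - α) + ((k : ℝ) - 1 / 2) ^ (1 - α))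

open Set Filter Topology

/-- Mean value theorem for `t ↦ t ^ r` on the positive reals. -/
lemma Real.exists_rpow_sub_rpow_eq {a b : ℝ} (r : ℝ) (ha : 0 < a) (hab : a < b) :
    ∃ c ∈ Ioo a b, b ^ r - a ^ r = r * c ^ (r - 1) * (b - a) := by
  have hd : ∀ x, 0 < x → HasDerivAt (fun t : ℝ => t ^ r) (r * x ^ (r - 1)) x := fun x hx =>
    Real.hasDerivAt_rpow_const (Or.inl hx.ne')
  obtain ⟨c, hc, h⟩ := exists_hasDerivAt_eq_slope (fun t : ℝ => t ^ r)
    (fun t => r * t ^ (r - 1)) hab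
    (fun x hx => (hd x (ha.trans_le hx.1)).continuousAt.continuousWithinAt)
    (fun x hx => hd x (ha.trans hx.1))
  exact ⟨c, hc, by rw [h, div_mul_cancel₀ _ (sub_pos.2 hab).ne']⟩

/-- Strict tangent line inequality for `t ↦ t ^ q` with `q < 0`, with tangent point `c`. -/
lemma Real.rpow_add_mul_rpow_sub_one_lt_rpow {a c q : ℝ} (hq : q < 0) (ha : 0 < a) (hac : a < c) :
    c ^ q + q * c ^ (q - 1) * (a - c) < a ^ q := by
  have hc : 0 < c := ha.trans hac
  have hlog : Real.log (a / c) < a / c - 1 :=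
    Real.log_lt_sub_one_of_pos (div_pos ha hc) ((div_lt_one hc).2 hac).ne
  have hratio : 1 + q * (a / c - 1) < (a / c) ^ q := by
    rw [Real.rpow_def_of_pos (div_pos ha hc)]
    nlinarith [Real.add_one_le_exp (Real.log (a / c) * q), mul_lt_mul_of_neg_left hlog hq]
  rw [Real.div_rpow ha.le hc.le, lt_div_iff₀ (Real.rpow_pos_of_pos hc q)] at hratio
  calc c ^ q + q * c ^ (q - 1) * (a - c) = (1 + q * (a / c - 1)) * c ^ q := by
        rw [Real.rpow_sub_one hc.ne']
        field_simp
    _ < a ^ q := hratio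

/-- Strict trapezoidal inequality for the strictly convex function `t ↦ p * t ^ (p - 1)`. -/
lemma Real.rpow_sub_rpow_lt_trapezoid {a b p : ℝ} (hp0 : 0 < p) (hp1 : p < 1) (ha : 0 < a)
    (hab : a < b) :
    b ^ p - a ^ p < p / 2 * (b - a) * (a ^ (p - 1) + b ^ (p - 1)) := by
  have hd : ∀ x ∈ Ici a, HasDerivAt
      (fun t : ℝ => p / 2 * (t - a) * (a ^ (p - 1) + t ^ (p - 1)) - t ^ p)
      (p / 2 * 1 * (a ^ (p - 1) + x ^ (p - 1)) +
        p / 2 * (x - a) * ((p - 1) * x ^ (p - 1 - 1)) - p * x ^ (p - 1)) x := fun x hx => by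
    have hx0 : x ≠ 0 := (ha.trans_le hx).ne'
    exact ((((hasDerivAt_id x).sub_const a).const_mul (p / 2)).mul
      ((Real.hasDerivAt_rpow_const (Or.inl hx0)).const_add _)).sub
      (Real.hasDerivAt_rpow_const (Or.inl hx0))
  have hmono := strictMonoOn_of_deriv_pos (convex_Ici a)
    (fun x hx => (hd x hx).continuousAt.continuousWithinAt) (fun x hx => by
      rw [interior_Ici] at hx
      rw [(hd x (mem_Ici.2 (le_of_lt hx))).deriv]
      have := Real.rpow_add_mul_rpow_sub_one_lt_rpow (sub_neg.2 hp1) ha hx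
      nlinarith)
  have := hmono self_mem_Ici hab.le hab
  simp only [sub_self, mul_zero, zero_mul, zero_sub] at this
  linarith

lemma bC_succ_lt {α : ℝ} (hα0 : 0 < α) (hα1 : α < 1) {k : ℕ} (hk : 1 ≤ k) :
    bC α (k + 1) < bC α k := by
  have hd : ∀ x ∈ Ici (1 : ℝ), HasDerivAt
      (fun x : ℝ => (1 / (2 - α)) * ((x + 1 / 2) ^ (2 - α) - (x - 1 / 2) ^ (2 - α))
        - (1 / 2) * ((x + 1 / 2) ^ (1 - α) + (x - 1 / 2) ^ (1 - α)))
      ((1 / (2 - α)) * (1 * (2 - α) * (x + 1 / 2) ^ (2 - α - 1)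
          - 1 * (2 - α) * (x - 1 / 2) ^ (2 - α - 1))
        - (1 / 2) * (1 * (1 - α) * (x + 1 / 2) ^ (1 - α - 1)
          + 1 * (1 - α) * (x - 1 / 2) ^ (1 - α - 1))) x := fun x hx => by
    have hx : 1 ≤ x := hx
    have h₁ : x + 1 / 2 ≠ 0 := by linarith
    have h₂ : x - 1 / 2 ≠ 0 := by linarith
    have hp := (hasDerivAt_id x).add_const (1 / 2 : ℝ)
    have hm := (hasDerivAt_id x).sub_const (1 / 2 : ℝ)
    exact (((hp.rpow_const (Or.inl h₁)).sub (hm.rpow_const (Or.inl h₂))).const_mul _).sub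
      (((hp.rpow_const (Or.inl h₁)).add (hm.rpow_const (Or.inl h₂))).const_mul _)
  have hanti := strictAntiOn_of_deriv_neg (convex_Ici 1)
    (fun x hx => (hd x hx).continuousAt.continuousWithinAt) (fun x hx => by
      rw [interior_Ici] at hx
      rw [(hd x (mem_Ici.2 (le_of_lt hx))).deriv]
      have hx : 1 < x := hx
      have h := Real.rpow_sub_rpow_lt_trapezoid (p := 1 - α) (a := x - 1 / 2) (b := x + 1 / 2)
        (by linarith) (by linarith) (by linarith) (by linarith)
      have h2 : 2 - α ≠ 0 := by linarith
      rw [show 2 - α - 1 = 1 - α by ring, one_mul, ← mul_sub, ← mul_assoc, one_div_mul_cancel h2]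
      linarith)
  have hk' : (1 : ℝ) ≤ k := by exact_mod_cast hk
  have := hanti (a := (k : ℝ)) (b := ((k + 1 : ℕ) : ℝ)) hk' (by push_cast; exact hk'.trans (by simp))
    (by simp)
  exact this

lemma abs_bC_le {α : ℝ} (hα0 : 0 < α) (hα1 : α < 1) {k : ℕ} (hk : 1 ≤ k) :
    |bC α k| ≤ ((k : ℝ) - 1 / 2) ^ (-α) := by
  have hk' : (1 : ℝ) ≤ k := by exact_mod_cast hk
  have ha : (0 : ℝ) < k - 1 / 2 := by linarith
  have hab : (k : ℝ) - 1 / 2 < k + 1 / 2 := by linarith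
  obtain ⟨c, hc, hc'⟩ := Real.exists_rpow_sub_rpow_eq (2 - α) ha hab
  obtain ⟨d, hd, hd'⟩ := Real.exists_rpow_sub_rpow_eq (1 - α) ha hab
  have h2 : 2 - α ≠ 0 := by linarith
  have hc0 := ha.trans hc.1
  have hlow : ((k : ℝ) - 1 / 2) ^ (1 - α) ≤ c ^ (1 - α) :=
    Real.rpow_le_rpow ha.le hc.1.le (by linarith)
  have hupp : c ^ (1 - α) ≤ ((k : ℝ) + 1 / 2) ^ (1 - α) :=
    Real.rpow_le_rpow hc0.le hc.2.le (by linarith)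
  have hdle : d ^ (-α) ≤ ((k : ℝ) - 1 / 2) ^ (-α) :=
    Real.rpow_le_rpow_of_nonpos ha hd.1.le (by linarith)
  have hdpos : 0 < d ^ (-α) := Real.rpow_pos_of_pos (ha.trans hd.1) _
  have hb : bC α k = c ^ (1 - α)
      - (1 / 2) * (((k : ℝ) + 1 / 2) ^ (1 - α) + ((k : ℝ) - 1 / 2) ^ (1 - α)) := by
    rw [bC, hc', show 2 - α - 1 = 1 - α by ring]
    field_simp
    ring
  rw [show 1 - α - 1 = -α by ring] at hd'
  rw [hb, abs_le]
  constructor <;> nlinarith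

lemma tendsto_bC {α : ℝ} (hα0 : 0 < α) (hα1 : α < 1) :
    Tendsto (fun k : ℕ => bC α k) atTop (𝓝 0) := by
  refine squeeze_zero_norm' (a := fun k : ℕ => ((k : ℝ) - 1 / 2) ^ (-α)) ?_ ?_
  · filter_upwards [eventually_ge_atTop 1] with k hk
    exact abs_bC_le hα0 hα1 hk
  · exact (tendsto_rpow_neg_atTop hα0).comp
      (tendsto_atTop_add_const_right _ (-(1 / 2)) tendsto_natCast_atTop_atTop)

/-- Lemma 2(2): positivity, convergence to zero, and strict monotonicity of the
coefficients `b_k^{(α)}` for `k ≥ 1`. -/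
theorem bC_pos_tendsto_antitone (α : ℝ) (hα0 : 0 < α) (hα1 : α < 1) :
    (∀ k : ℕ, 1 ≤ k → 0 < bC α k) ∧
    Filter.Tendsto (fun k : ℕ => bC α k) Filter.atTop (nhds 0) ∧
    (∀ k : ℕ, 1 ≤ k → bC α (k + 1) < bC α k) := by
  refine ⟨fun k hk => ?_, tendsto_bC hα0 hα1, fun k hk => bC_succ_lt hα0 hα1 hk⟩
  have hanti : Antitone fun n : ℕ => bC α (n + (k + 1)) := antitone_nat_of_succ_le fun n => by
    rw [Nat.add_right_comm]
    exact (bC_succ_lt hα0 hα1 (by omega)).le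
  have hnonneg := hanti.le_of_tendsto ((tendsto_add_atTop_iff_nat (k + 1)).2 (tendsto_bC hα0 hα1)) 0
  rw [Nat.zero_add] at hnonneg
  exact hnonneg.trans_lt (bC_succ_lt hα0 hα1 hk)
end

section
/- For every α ∈ (0,1), every integer n ≥ 5, and every integer k with 2 ≤ k ≤ n−3 (so that k ≥ 2 and k ≠ n−2), one has c_{k+1}^{(α)} − 2c_k^{(α)} + c_{k−1}^{(α)} > 0. -/
/-- `a`-coefficients for `α ∈ (0,1)`:
`a_0 = (1/2)^(1-α)`, `a_k = (k+1/2)^(1-α) - (k-1/2)^(1-α)` for `k ≥ 1`. -/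
noncomputable def aC (α : ℝ) (k : ℕ) : ℝ :=
  if k = 0 then (1 / 2 : ℝ) ^ (1 - α)
  else ((k : ℝ) + 1 / 2) ^ (1 - α) - ((k : ℝ) - 1 / 2) ^ (1 - α)

/-- `c`-coefficients at time level `n`: for `n = 1`, `c_0 = a_0`; for `n ≥ 2`,
`c_0 = a_0 + b_1`, `c_k = a_k + b_{k+1} - b_k` for `1 ≤ k ≤ n-2`, and
`c_{n-1} = a_{n-1} - b_{n-1}`. -/
noncomputable def cC (α : ℝ) (n k : ℕ) : ℝ :=
  if n ≤ 1 then aC α k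
  else if k = 0 then aC α 0 + bC α 1
  else if k = n - 1 then aC α (n - 1) - bC α (n - 1)
  else aC α k + bC α (k + 1) - bC α k

theorem strictConvexOn_Ioi_of_hasDerivAt2_pos {a : ℝ} {f f' f'' : ℝ → ℝ}
    (hf : ∀ x, a < x → HasDerivAt f (f' x) x)
    (hf' : ∀ x, a < x → HasDerivAt f' (f'' x) x) (hpos : ∀ x, a < x → 0 < f'' x) :
    StrictConvexOn ℝ (Set.Ioi a) f := by
  refine strictConvexOn_of_deriv2_pos' (convex_Ioi a)
    (fun x hx => (hf x hx).continuousAt.continuousWithinAt) fun x hx => ?_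
  have heq : deriv f =ᶠ[nhds x] f' := by
    filter_upwards [Ioi_mem_nhds hx] with y hy using (hf y hy).deriv
  simpa [heq.deriv_eq, (hf' x hx).deriv] using hpos x hx

theorem StrictConvexOn.central_second_difference_pos {a : ℝ} {f : ℝ → ℝ}
    (hf : StrictConvexOn ℝ (Set.Ioi a) f) {x : ℝ} (hx : a + 1 < x) :
    0 < f (x + 1) - 2 * f x + f (x - 1) := by
  have h := hf.2 (Set.mem_Ioi.2 (by linarith : a < x + 1))
    (Set.mem_Ioi.2 (by linarith : a < x - 1)) (by linarith)
    (by norm_num : (0 : ℝ) < 1 / 2) (by norm_num : (0 : ℝ) < 1 / 2) (by norm_num)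
  have hmid : (1 / 2 : ℝ) • (x + 1) + (1 / 2 : ℝ) • (x - 1) = x := by
    simp only [smul_eq_mul]; ring
  rw [hmid] at h
  simp only [smul_eq_mul] at h
  linarith

theorem HasDerivAt.central_second_difference {f f' : ℝ → ℝ} {a x : ℝ}
    (hf : ∀ y, a < y → HasDerivAt f (f' y) y) (hx : a + 1 < x) :
    HasDerivAt (fun y => f (y + 1) - 2 * f y + f (y - 1))
      (f' (x + 1) - 2 * f' x + f' (x - 1)) x :=
  (((hf (x + 1) (by linarith)).comp_add_const x 1).sub
    ((hf x (by linarith)).const_mul 2)).add ((hf (x - 1) (by linarith)).comp_sub_const x 1)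

/-- If the fourth derivative of `f` is positive on `(a, ∞)`, then the central second difference of `f` is strictly
convex on `(a + 1, ∞)`. -/
theorem strictConvexOn_central_second_difference {a : ℝ} {f f₁ f₂ f₃ f₄ : ℝ → ℝ}
    (h₁ : ∀ x, a < x → HasDerivAt f (f₁ x) x) (h₂ : ∀ x, a < x → HasDerivAt f₁ (f₂ x) x)
    (h₃ : ∀ x, a < x → HasDerivAt f₂ (f₃ x) x) (h₄ : ∀ x, a < x → HasDerivAt f₃ (f₄ x) x)
    (hpos : ∀ x, a < x → 0 < f₄ x) :
    StrictConvexOn ℝ (Set.Ioi (a + 1)) fun x => f (x + 1) - 2 * f x + f (x - 1) :=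
  strictConvexOn_Ioi_of_hasDerivAt2_pos
    (fun _ hx => HasDerivAt.central_second_difference h₁ hx)
    (fun _ hx => HasDerivAt.central_second_difference h₂ hx)
    fun _ hx =>
      (strictConvexOn_Ioi_of_hasDerivAt2_pos h₃ h₄ hpos).central_second_difference_pos hx

theorem hasDerivAt_rpow_linear_combination (A B p q : ℝ) {x : ℝ} (hx : 0 < x) :
    HasDerivAt (fun y : ℝ => A * y ^ p + B * y ^ q)
      (A * p * x ^ (p - 1) + B * q * x ^ (q - 1)) x := by
  simp only [mul_assoc]
  exact ((Real.hasDerivAt_rpow_const (Or.inl hx.ne')).const_mul A).add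
      ((Real.hasDerivAt_rpow_const (Or.inl hx.ne')).const_mul B)

/-- The function whose central second difference at `k + 1 / 2` is `c_k`. -/
noncomputable def cPotential (α x : ℝ) : ℝ :=
  1 / (2 - α) * x ^ (2 - α) + -(1 / 2) * x ^ (1 - α)

theorem strictConvexOn_cPotential_second_difference {α : ℝ} (hα0 : 0 < α) (hα1 : α < 1) :
    StrictConvexOn ℝ (Set.Ioi (0 + 1)) fun x =>
      cPotential α (x + 1) - 2 * cPotential α x + cPotential α (x - 1) := by
  refine strictConvexOn_central_second_difference
    (fun x hx => hasDerivAt_rpow_linear_combination _ _ _ _ hx)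
    (fun x hx => hasDerivAt_rpow_linear_combination _ _ _ _ hx)
    (fun x hx => hasDerivAt_rpow_linear_combination _ _ _ _ hx)
    (fun x hx => hasDerivAt_rpow_linear_combination _ _ _ _ hx) fun x hx => ?_
  have h₁ : 0 < 1 - α := by linarith
  have h₂ : 0 < 2 - α := by linarith
  have hA : 1 / (2 - α) * (2 - α) * (2 - α - 1) * (2 - α - 1 - 1) * (2 - α - 1 - 1 - 1)
      = (1 - α) * α * (α + 1) := by
    field_simp; ring
  have hB : -(1 / 2) * (1 - α) * (1 - α - 1) * (1 - α - 1 - 1) * (1 - α - 1 - 1 - 1)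
      = 1 / 2 * (1 - α) * α * (α + 1) * (α + 2) := by
    ring
  rw [hA, hB]
  positivity

theorem cC_eq_cPotential_second_difference (α : ℝ) {n k : ℕ} (hk : 1 ≤ k) (hkn : k + 2 ≤ n) :
    cC α n k = cPotential α ((k : ℝ) + 1 / 2 + 1) - 2 * cPotential α ((k : ℝ) + 1 / 2)
      + cPotential α ((k : ℝ) + 1 / 2 - 1) := by
  have h₁ : ¬ n ≤ 1 := by omega
  have h₂ : k ≠ 0 := by omega
  have h₃ : k ≠ n - 1 := by omega
  have e₁ : (k : ℝ) + 1 + 1 / 2 = k + 1 / 2 + 1 := by ring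
  have e₂ : (k : ℝ) + 1 - 1 / 2 = k + 1 / 2 := by ring
  have e₃ : (k : ℝ) - 1 / 2 = k + 1 / 2 - 1 := by ring
  simp only [cC, aC, bC, cPotential, if_neg h₁, if_neg h₂, if_neg h₃, Nat.cast_add,
    Nat.cast_one, e₁, e₂, e₃]
  ring

/-- Lemma 3(3): strict convexity of the coefficients `c_k^{(α)}` for `2 ≤ k ≤ n-3`. -/
theorem cC_second_difference_pos (α : ℝ) (hα0 : 0 < α) (hα1 : α < 1)
    (n : ℕ) (hn : 5 ≤ n) (k : ℕ) (hk2 : 2 ≤ k) (hk3 : k ≤ n - 3) :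
    0 < cC α n (k + 1) - 2 * cC α n k + cC α n (k - 1) := by
  obtain ⟨k, rfl⟩ : ∃ m, k = m + 1 := ⟨k - 1, by omega⟩
  rw [Nat.add_sub_cancel, cC_eq_cPotential_second_difference α (by omega) (by omega),
    cC_eq_cPotential_second_difference α (by omega) (by omega),
    cC_eq_cPotential_second_difference α (by omega) (by omega)]
  have hk : (1 : ℝ) ≤ k := by exact_mod_cast (by omega : 1 ≤ k)
  have h := (strictConvexOn_cPotential_second_difference hα0 hα1).central_second_difference_pos
    (x := (k : ℝ) + 1 + 1 / 2) (by linarith)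
  have e₁ : (k : ℝ) + 1 + 1 + 1 / 2 = k + 1 + 1 / 2 + 1 := by ring
  have e₂ : (k : ℝ) + 1 / 2 = k + 1 + 1 / 2 - 1 := by ring
  simpa only [Nat.cast_add, Nat.cast_one, e₁, e₂] using h
end

section
/- For every α ∈ (0,1) and every integer k ≥ 2, the second difference of the sequence g_k = a_k^{(α)} + b_{k+1}^{(α)} − b_k^{(α)} satisfies g_{k+1} − 2g_k + g_{k−1} > α(1−α)(1+α)·(k+5/2)^{−(2+α)} + (α(1−α)(1+α)(2+α)/2)·(k+5/2)^{−(3+α)}; in particular g_{k+1} − 2g_k + g_{k−1} > 0. -/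
/-- Forward differences with step one of a function differentiable on the positive axis. -/
theorem hasDerivAt_forward_difference {h h' : ℝ → ℝ}
    (hh : ∀ x, 0 < x → HasDerivAt h (h' x) x) (x : ℝ) (hx : 0 < x) :
    HasDerivAt (fun y => h (y + 1) - h y) (h' (x + 1) - h' x) x :=
  ((hh (x + 1) (by linarith)).comp_add_const x 1).sub (hh x hx)

/-- The mean value theorem on `[x, x + 1]`. -/
theorem exists_forward_difference_eq {h h' : ℝ → ℝ}
    (hh : ∀ x, 0 < x → HasDerivAt h (h' x) x) (x : ℝ) (hx : 0 < x) :
    ∃ ξ, x < ξ ∧ ξ < x + 1 ∧ h (x + 1) - h x = h' ξ := by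
  obtain ⟨ξ, hξ, he⟩ := exists_hasDerivAt_eq_slope h h' (show x < x + 1 by linarith)
    (fun y hy => (hh y (hx.trans_le hy.1)).continuousAt.continuousWithinAt)
    (fun y hy => hh y (hx.trans hy.1))
  exact ⟨ξ, hξ.1, hξ.2, by rw [he]; simp⟩

/-- The fourth forward difference is a value of the fourth derivative. -/
theorem exists_fourth_difference_eq {h h₁ h₂ h₃ h₄ : ℝ → ℝ}
    (d₁ : ∀ x, 0 < x → HasDerivAt h (h₁ x) x) (d₂ : ∀ x, 0 < x → HasDerivAt h₁ (h₂ x) x)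
    (d₃ : ∀ x, 0 < x → HasDerivAt h₂ (h₃ x) x) (d₄ : ∀ x, 0 < x → HasDerivAt h₃ (h₄ x) x)
    (x : ℝ) (hx : 0 < x) :
    ∃ ξ, x < ξ ∧ ξ < x + 4 ∧
      h (x + 4) - 4 * h (x + 3) + 6 * h (x + 2) - 4 * h (x + 1) + h x = h₄ ξ := by
  obtain ⟨a, ha, ha', ea⟩ := exists_forward_difference_eq
    (hasDerivAt_forward_difference (hasDerivAt_forward_difference
      (hasDerivAt_forward_difference d₁))) x hx
  obtain ⟨b, hb, hb', eb⟩ := exists_forward_difference_eq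
    (hasDerivAt_forward_difference (hasDerivAt_forward_difference d₂)) a (by linarith)
  obtain ⟨c, hc, hc', ec⟩ := exists_forward_difference_eq
    (hasDerivAt_forward_difference d₃) b (by linarith)
  obtain ⟨d, hd, hd', ed⟩ := exists_forward_difference_eq d₄ c (by linarith)
  refine ⟨d, by linarith, by linarith, ?_⟩
  rw [← ed, ← ec, ← eb, ← ea]
  norm_num only [add_assoc]
  ring

/-- The fourth forward difference of a real power. -/
theorem exists_fourth_difference_rpow_eq (s x : ℝ) (hx : 0 < x) :
    ∃ ξ, x < ξ ∧ ξ < x + 4 ∧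
      (x + 4) ^ s - 4 * (x + 3) ^ s + 6 * (x + 2) ^ s - 4 * (x + 1) ^ s + x ^ s
        = s * (s - 1) * (s - 2) * (s - 3) * ξ ^ (s - 4) := by
  have key : ∀ c t u : ℝ, u = t - 1 → ∀ y : ℝ, 0 < y →
      HasDerivAt (fun z : ℝ => c * z ^ t) (c * t * y ^ u) y := by
    rintro c t u rfl y hy
    simpa only [mul_assoc] using (Real.hasDerivAt_rpow_const (p := t) (Or.inl hy.ne')).const_mul c
  obtain ⟨ξ, h₁, h₂, e⟩ := exists_fourth_difference_eq
    (key 1 s (s - 1) rfl) (key (1 * s) (s - 1) (s - 2) (by ring))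
    (key (1 * s * (s - 1)) (s - 2) (s - 3) (by ring))
    (key (1 * s * (s - 1) * (s - 2)) (s - 3) (s - 4) (by ring)) x hx
  exact ⟨ξ, h₁, h₂, by simpa only [one_mul] using e⟩

/-- The second difference of `g_k = a_k + b_{k+1} - b_k` admits an explicit positive
lower bound; in particular it is positive. -/
theorem g_second_difference_lower_bound (α : ℝ) (hα0 : 0 < α) (hα1 : α < 1)
    (k : ℕ) (hk : 2 ≤ k) :
    (α * (1 - α) * (1 + α) * ((k : ℝ) + 5 / 2) ^ (-(2 + α))
        + α * (1 - α) * (1 + α) * (2 + α) / 2 * ((k : ℝ) + 5 / 2) ^ (-(3 + α))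
      < (aC α (k + 1) + bC α (k + 2) - bC α (k + 1))
          - 2 * (aC α k + bC α (k + 1) - bC α k)
          + (aC α (k - 1) + bC α k - bC α (k - 1))) ∧
    0 < (aC α (k + 1) + bC α (k + 2) - bC α (k + 1))
          - 2 * (aC α k + bC α (k + 1) - bC α k)
          + (aC α (k - 1) + bC α k - bC α (k - 1)) := by
  obtain ⟨j, rfl⟩ := Nat.exists_eq_add_of_le' hk
  have hx : (0 : ℝ) < j + 1 / 2 := by positivity
  have hC : 0 < α * (1 - α) * (1 + α) := by
    have : 0 < 1 - α := by linarith
    positivity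
  obtain ⟨ξ, h₁, h₂, e⟩ := exists_fourth_difference_rpow_eq (2 - α) _ hx
  obtain ⟨η, h₃, h₄, e'⟩ := exists_fourth_difference_rpow_eq (1 - α) _ hx
  have p₁ : ((j : ℝ) + 1 / 2 + 4) ^ (-(2 + α)) < ξ ^ (-(2 + α)) :=
    Real.rpow_lt_rpow_of_neg (hx.trans h₁) h₂ (by linarith)
  have p₂ : ((j : ℝ) + 1 / 2 + 4) ^ (-(3 + α)) < η ^ (-(3 + α)) :=
    Real.rpow_lt_rpow_of_neg (hx.trans h₃) h₄ (by linarith)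
  rw [show 2 - α - 4 = -(2 + α) by ring] at e
  rw [show 1 - α - 4 = -(3 + α) by ring] at e'
  have q₁ := mul_lt_mul_of_pos_left p₁ hC
  have q₂ := mul_lt_mul_of_pos_left p₂
    (show 0 < α * (1 - α) * (1 + α) * (2 + α) / 2 by positivity)
  have r : (aC α (j + 2 + 1) + bC α (j + 2 + 2) - bC α (j + 2 + 1))
        - 2 * (aC α (j + 2) + bC α (j + 2 + 1) - bC α (j + 2))
        + (aC α (j + 2 - 1) + bC α (j + 2) - bC α (j + 2 - 1))
      = α * (1 - α) * (1 + α) * ξ ^ (-(2 + α))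
        + α * (1 - α) * (1 + α) * (2 + α) / 2 * η ^ (-(3 + α)) := by
    have h2 : 2 - α ≠ 0 := by linarith
    have e₁ : 1 / (2 - α) * ((2 - α) * (2 - α - 1) * (2 - α - 2) * (2 - α - 3) * ξ ^ (-(2 + α)))
        = α * (1 - α) * (1 + α) * ξ ^ (-(2 + α)) := by
      field_simp
      ring
    have e₂ : -(1 / 2) * ((1 - α) * (1 - α - 1) * (1 - α - 2) * (1 - α - 3) * η ^ (-(3 + α)))
        = α * (1 - α) * (1 + α) * (2 + α) / 2 * η ^ (-(3 + α)) := by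
      ring
    rw [← e₁, ← e₂, ← e, ← e', show j + 2 - 1 = j + 1 from rfl]
    simp only [aC, bC, Nat.add_eq_zero_iff, OfNat.ofNat_ne_zero, one_ne_zero, and_false, if_false,
      Nat.cast_add, Nat.cast_ofNat, Nat.cast_one]
    norm_num only [add_assoc, add_sub_assoc]
    ring
  have y : ((j + 2 : ℕ) : ℝ) + 5 / 2 = j + 1 / 2 + 4 := by
    push_cast
    ring
  rw [r, y]
  have := hx.trans h₁
  have := hx.trans h₃
  exact ⟨by linarith, by positivity⟩
end

section
/- Let α ∈ (0,1), let N be a positive integer, and let v_1, v_2, …, v_N be real numbers. Then Σ_{n=1}^{N} Σ_{k=1}^{n} c_{n−k}^{(n,α)} v_k v_n ≥ 0, where for each n the coefficients c_j^{(n,α)} (0 ≤ j ≤ n−1) are the coefficients c_j^{(α)} associated with time level n. -/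
/-- A weighted sum of three consecutive unit shifts of `q`. -/
def shiftSum (w₀ w₁ w₂ : ℝ) (q : ℝ → ℝ) (t : ℝ) : ℝ :=
  w₀ * q t + w₁ * q (t + 1) + w₂ * q (t + 2)

/-- The shift weights that are nonnegative on every negative power. -/
def NonnegOnNegPowers (w₀ w₁ w₂ : ℝ) : Prop :=
  ∀ s : ℝ, 0 < s → ∀ x : ℝ, 0 < x → 0 ≤ shiftSum w₀ w₁ w₂ (fun y => y ^ (-s)) x

lemma nonnegOnNegPowers_id : NonnegOnNegPowers 1 0 0 := by
  intro s _ x hx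
  simp only [shiftSum]
  have := Real.rpow_nonneg hx.le (-s)
  linarith

lemma nonnegOnNegPowers_diff : NonnegOnNegPowers 1 (-1) 0 := by
  intro s hs x hx
  simp only [shiftSum]
  have := Real.rpow_le_rpow_of_nonpos hx (by linarith : x ≤ x + 1) (by linarith : -s ≤ 0)
  linarith

lemma nonnegOnNegPowers_secondDiff : NonnegOnNegPowers 1 (-2) 1 := by
  intro s hs x hx
  simp only [shiftSum]
  have hsq : ∀ y : ℝ, 0 < y → y ^ (-s) = (y ^ (-(s / 2))) ^ 2 := fun y hy => by
    rw [← Real.rpow_mul_natCast hy.le]; congr 1; push_cast; ring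
  have hmid : ((x + 1) ^ (-(s / 2))) ^ 2 ≤ x ^ (-(s / 2)) * (x + 2) ^ (-(s / 2)) := by
    rw [sq, ← Real.mul_rpow (by linarith) (by linarith), ← Real.mul_rpow hx.le (by linarith)]
    exact Real.rpow_le_rpow_of_nonpos (by positivity) (by nlinarith) (by linarith)
  rw [hsq x hx, hsq (x + 1) (by linarith), hsq (x + 2) (by linarith)]
  linarith [sq_nonneg (x ^ (-(s / 2)) - (x + 2) ^ (-(s / 2)))]

lemma NonnegOnNegPowers.antitoneOn {w₀ w₁ w₂ s : ℝ} (hw : NonnegOnNegPowers w₀ w₁ w₂)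
    (hs : 0 < s) : AntitoneOn (shiftSum w₀ w₁ w₂ fun y => y ^ (-s)) (Set.Ioi 0) := by
  have hd : ∀ c : ℝ, 0 ≤ c → ∀ x : ℝ, 0 < x →
      HasDerivAt (fun y : ℝ => (y + c) ^ (-s)) (-s * (x + c) ^ (-(s + 1))) x := by
    intro c hc x hx
    have := ((hasDerivAt_id x).add_const c).rpow_const (p := -s) (Or.inl (by simp; linarith))
    refine this.congr_deriv ?_
    rw [show -(s + 1) = -s - 1 by ring, id_eq]; ring
  have hD : ∀ x : ℝ, 0 < x → HasDerivAt (shiftSum w₀ w₁ w₂ fun y => y ^ (-s))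
      (-s * shiftSum w₀ w₁ w₂ (fun y => y ^ (-(s + 1))) x) x := by
    intro x hx
    have h0 := hd 0 le_rfl x hx
    simp only [add_zero] at h0
    have := ((h0.const_mul w₀).add ((hd 1 zero_le_one x hx).const_mul w₁)).add
      ((hd 2 zero_le_two x hx).const_mul w₂)
    refine this.congr_deriv ?_
    simp only [shiftSum]; ring
  refine antitoneOn_of_deriv_nonpos (convex_Ioi 0)
    (fun x hx => (hD x hx).continuousAt.continuousWithinAt) ?_ ?_
  · intro x hx
    rw [interior_Ioi] at hx
    exact (hD x hx).differentiableAt.differentiableWithinAt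
  · intro x hx
    rw [interior_Ioi] at hx
    rw [(hD x hx).deriv]
    have := hw (s + 1) (by linarith) x hx
    nlinarith

/-- The error of the trapezoidal rule for `x ^ (1 - α)` on `[t - h, t + h]`. -/
noncomputable def trapezoidError (α h t : ℝ) : ℝ :=
  1 / (2 - α) * ((t + h) ^ (2 - α) - (t - h) ^ (2 - α)) -
    h * ((t + h) ^ (1 - α) + (t - h) ^ (1 - α))

/-- The central difference of `x ^ (1 - α)`. -/
noncomputable def centralDiff (α h t : ℝ) : ℝ := (t + h) ^ (1 - α) - (t - h) ^ (1 - α)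

lemma hasDerivAt_add_rpow {p t h : ℝ} (ht : 0 < t + h) :
    HasDerivAt (fun h : ℝ => (t + h) ^ p) (p * (t + h) ^ (p - 1)) h := by
  have := ((hasDerivAt_id h).const_add t).rpow_const (p := p) (Or.inl (by simp; linarith))
  exact this.congr_deriv (by simp)

lemma hasDerivAt_sub_rpow {p t h : ℝ} (ht : 0 < t - h) :
    HasDerivAt (fun h : ℝ => (t - h) ^ p) (-(p * (t - h) ^ (p - 1))) h := by
  have := ((hasDerivAt_id h).const_sub t).rpow_const (p := p) (Or.inl (by simp; linarith))
  exact this.congr_deriv (by simp)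

lemma hasDerivAt_trapezoidError {α t h : ℝ} (hα : α < 1) (h₁ : 0 < t + h) (h₂ : 0 < t - h) :
    HasDerivAt (fun h => trapezoidError α h t)
      (h * (1 - α) * ((t - h) ^ (-α) - (t + h) ^ (-α))) h := by
  have := (((hasDerivAt_add_rpow (p := 2 - α) h₁).sub
    (hasDerivAt_sub_rpow (p := 2 - α) h₂)).const_mul (1 / (2 - α))).sub
    ((hasDerivAt_id h).mul ((hasDerivAt_add_rpow (p := 1 - α) h₁).add
      (hasDerivAt_sub_rpow (p := 1 - α) h₂)))
  refine this.congr_deriv ?_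
  simp only [id_eq, Pi.add_apply]
  rw [show 2 - α - 1 = 1 - α by ring, show 1 - α - 1 = -α by ring]
  have : 2 - α ≠ 0 := by linarith
  field_simp
  ring

lemma hasDerivAt_centralDiff {α t h : ℝ} (h₁ : 0 < t + h) (h₂ : 0 < t - h) :
    HasDerivAt (fun h => centralDiff α h t)
      ((1 - α) * ((t + h) ^ (-α) + (t - h) ^ (-α))) h := by
  have := (hasDerivAt_add_rpow (p := 1 - α) h₁).sub (hasDerivAt_sub_rpow (p := 1 - α) h₂)
  refine this.congr_deriv ?_
  rw [show 1 - α - 1 = -α by ring]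
  ring

lemma nonneg_of_hasDerivAt_nonneg {g g' : ℝ → ℝ} (h0 : g 0 = 0)
    (hg : ∀ h ∈ Set.Icc (0 : ℝ) (1 / 2), HasDerivAt g (g' h) h)
    (hg' : ∀ h ∈ Set.Icc (0 : ℝ) (1 / 2), 0 ≤ g' h) : 0 ≤ g (1 / 2) := by
  have hm : MonotoneOn g (Set.Icc 0 (1 / 2)) := by
    refine monotoneOn_of_deriv_nonneg (convex_Icc _ _)
      (fun x hx => (hg x hx).continuousAt.continuousWithinAt) ?_ ?_
    · exact fun x hx => (hg x (interior_subset hx)).differentiableAt.differentiableWithinAt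
    · intro x hx
      rw [(hg x (interior_subset hx)).deriv]
      exact hg' x (interior_subset hx)
  rw [← h0]
  exact hm (by simp) (by simp) (by norm_num)

lemma HasDerivAt.shiftSum {q q' : ℝ → ℝ → ℝ} {h t : ℝ} (w₀ w₁ w₂ : ℝ)
    (hq : ∀ u, t ≤ u → HasDerivAt (fun h => q h u) (q' h u) h) :
    HasDerivAt (fun h => shiftSum w₀ w₁ w₂ (q h) t) (shiftSum w₀ w₁ w₂ (q' h) t) h :=
  (((hq t le_rfl).const_mul w₀).add ((hq (t + 1) (by linarith)).const_mul w₁)).add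
    ((hq (t + 2) (by linarith)).const_mul w₂)

lemma shiftSum_trapezoidError_nonneg {w₀ w₁ w₂ α t : ℝ} (hw : NonnegOnNegPowers w₀ w₁ w₂)
    (hα0 : 0 < α) (hα1 : α < 1) (ht : 1 ≤ t) :
    0 ≤ shiftSum w₀ w₁ w₂ (trapezoidError α (1 / 2)) t := by
  refine nonneg_of_hasDerivAt_nonneg (g := fun h => shiftSum w₀ w₁ w₂ (trapezoidError α h) t)
    (by simp [shiftSum, trapezoidError])
    (fun h hh => HasDerivAt.shiftSum (q := trapezoidError α)
      (q' := fun h u => h * (1 - α) * ((u - h) ^ (-α) - (u + h) ^ (-α)))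
      w₀ w₁ w₂ (fun u (hu : t ≤ u) => hasDerivAt_trapezoidError hα1
      (by linarith [hh.1]) (by linarith [hh.2]))) ?_
  rintro h ⟨h₁, h₂⟩
  have := hw.antitoneOn hα0 (Set.mem_Ioi.2 (by linarith : 0 < t - h))
    (Set.mem_Ioi.2 (by linarith : 0 < t + h)) (by linarith)
  have h3 := mul_nonneg (mul_nonneg h₁ (sub_nonneg.2 hα1.le)) (sub_nonneg.2 this)
  simp only [shiftSum] at h3 ⊢
  rw [show t + 1 - h = t - h + 1 by ring, show t + 2 - h = t - h + 2 by ring,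
    show t + 1 + h = t + h + 1 by ring, show t + 2 + h = t + h + 2 by ring]
  linarith

lemma shiftSum_centralDiff_sub_nonneg {w₀ w₁ w₂ α t : ℝ} (hw : NonnegOnNegPowers w₀ w₁ w₂)
    (hα0 : 0 < α) (hα1 : α < 1) (ht : 1 ≤ t) :
    0 ≤ shiftSum w₀ w₁ w₂
      (fun u => centralDiff α (1 / 2) u - trapezoidError α (1 / 2) u) t := by
  refine nonneg_of_hasDerivAt_nonneg
    (g := fun h => shiftSum w₀ w₁ w₂ (fun u => centralDiff α h u - trapezoidError α h u) t)
    (by simp [shiftSum, trapezoidError, centralDiff])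
    (fun h hh => HasDerivAt.shiftSum (q := fun h u => centralDiff α h u - trapezoidError α h u)
      (q' := fun h u => (1 - α) * ((u + h) ^ (-α) + (u - h) ^ (-α)) -
        h * (1 - α) * ((u - h) ^ (-α) - (u + h) ^ (-α))) w₀ w₁ w₂
      (fun u (hu : t ≤ u) => (hasDerivAt_centralDiff (by linarith [hh.1])
      (by linarith [hh.2])).sub (hasDerivAt_trapezoidError hα1
      (by linarith [hh.1]) (by linarith [hh.2])))) ?_
  rintro h ⟨h₁, h₂⟩
  have p₁ := mul_nonneg (mul_nonneg (by linarith : 0 ≤ 1 - h) (sub_nonneg.2 hα1.le))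
    (hw α hα0 (t - h) (by linarith))
  have p₂ := mul_nonneg (mul_nonneg (by linarith : 0 ≤ 1 + h) (sub_nonneg.2 hα1.le))
    (hw α hα0 (t + h) (by linarith))
  simp only [shiftSum] at p₁ p₂ ⊢
  rw [show t + 1 - h = t - h + 1 by ring, show t + 2 - h = t - h + 2 by ring,
    show t + 1 + h = t + h + 1 by ring, show t + 2 + h = t + h + 2 by ring]
  linarith

lemma bC_eq_trapezoidError (α : ℝ) (k : ℕ) : bC α k = trapezoidError α (1 / 2) k := rfl

lemma aC_sub_bC_eq {α : ℝ} {k : ℕ} (hk : 1 ≤ k) :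
    aC α k - bC α k = centralDiff α (1 / 2) k - trapezoidError α (1 / 2) k := by
  rw [bC_eq_trapezoidError, aC, if_neg (by omega), centralDiff]

lemma shiftSum_bC_nonneg {w₀ w₁ w₂ α : ℝ} (hw : NonnegOnNegPowers w₀ w₁ w₂)
    (hα0 : 0 < α) (hα1 : α < 1) {k : ℕ} (hk : 1 ≤ k) :
    0 ≤ w₀ * bC α k + w₁ * bC α (k + 1) + w₂ * bC α (k + 2) := by
  have := shiftSum_trapezoidError_nonneg hw hα0 hα1 (t := k) (by exact_mod_cast hk)
  simp only [bC_eq_trapezoidError]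
  push_cast
  exact this

lemma shiftSum_aC_sub_bC_nonneg {w₀ w₁ w₂ α : ℝ} (hw : NonnegOnNegPowers w₀ w₁ w₂)
    (hα0 : 0 < α) (hα1 : α < 1) {k : ℕ} (hk : 1 ≤ k) :
    0 ≤ w₀ * (aC α k - bC α k) + w₁ * (aC α (k + 1) - bC α (k + 1)) +
      w₂ * (aC α (k + 2) - bC α (k + 2)) := by
  have := shiftSum_centralDiff_sub_nonneg hw hα0 hα1 (t := k) (by exact_mod_cast hk)
  rw [aC_sub_bC_eq hk, aC_sub_bC_eq (by omega : 1 ≤ k + 1), aC_sub_bC_eq (by omega : 1 ≤ k + 2)]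
  push_cast
  exact this

lemma aC_one_le {α : ℝ} (hα0 : 0 < α) : aC α 1 ≤ 2 * aC α 0 := by
  have h3 : (3 : ℝ) ^ (1 - α) ≤ 3 := by
    simpa using Real.rpow_le_rpow_of_exponent_le (by norm_num : (1 : ℝ) ≤ 3)
      (by linarith : 1 - α ≤ 1)
  have e3 : (3 / 2 : ℝ) ^ (1 - α) = 3 ^ (1 - α) * (1 / 2) ^ (1 - α) := by
    rw [← Real.mul_rpow (by norm_num) (by norm_num)]; norm_num
  have hp : (0 : ℝ) ≤ (1 / 2) ^ (1 - α) := by positivity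
  simp only [aC, one_ne_zero, if_false, if_true, Nat.cast_one]
  norm_num at *
  rw [e3]
  nlinarith

lemma three_mul_three_rpow_le {α : ℝ} (hα0 : 0 < α) :
    3 * (3 : ℝ) ^ (1 - α) ≤ 4 + 5 ^ (1 - α) := by
  have h := Real.geom_mean_le_arith_mean2_weighted (w₁ := 4 / 9) (w₂ := 5 / 9) (p₁ := 1)
    (p₂ := (5 : ℝ) ^ (-α)) (by norm_num) (by norm_num) (by norm_num) (by positivity)
    (by norm_num)
  have h' : (3 : ℝ) ^ (-α) ≤ ((5 : ℝ) ^ (-α)) ^ (5 / 9 : ℝ) := by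
    have : (5 : ℝ) ^ (5 / 9 : ℝ) ≤ 3 := by
      rw [show (5 / 9 : ℝ) = 5 * (1 / 9) by norm_num, Real.rpow_mul (by norm_num)]
      calc ((5 : ℝ) ^ (5 : ℝ)) ^ (1 / 9 : ℝ) ≤ ((3 : ℝ) ^ (9 : ℝ)) ^ (1 / 9 : ℝ) := by
            apply Real.rpow_le_rpow (by positivity) _ (by norm_num)
            norm_num
        _ = 3 := by rw [← Real.rpow_mul (by norm_num)]; norm_num
    rw [← Real.rpow_mul (by norm_num), mul_comm, Real.rpow_mul (by norm_num)]
    exact Real.rpow_le_rpow_of_nonpos (by positivity) this (by linarith)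
  rw [Real.one_rpow, one_mul] at h
  rw [sub_eq_add_neg, Real.rpow_add (by norm_num), Real.rpow_add (by norm_num),
    Real.rpow_one, Real.rpow_one]
  linarith

lemma aC_secondDiff_nonneg {α : ℝ} (hα0 : 0 < α) :
    0 ≤ 2 * aC α 0 - 2 * aC α 1 + aC α 2 := by
  have h := three_mul_three_rpow_le hα0
  have e3 : (3 / 2 : ℝ) ^ (1 - α) = 3 ^ (1 - α) * (1 / 2) ^ (1 - α) := by
    rw [← Real.mul_rpow (by norm_num) (by norm_num)]; norm_num
  have e5 : (5 / 2 : ℝ) ^ (1 - α) = 5 ^ (1 - α) * (1 / 2) ^ (1 - α) := by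
    rw [← Real.mul_rpow (by norm_num) (by norm_num)]; norm_num
  have hp : (0 : ℝ) ≤ (1 / 2) ^ (1 - α) := by positivity
  simp only [aC, one_ne_zero, two_ne_zero, if_false, if_true, Nat.cast_one, Nat.cast_ofNat]
  norm_num at *
  rw [e3, e5]
  nlinarith

/-- Summation by parts for the increments of the squares `(x - p i) ^ 2` under `x ↦ x + y`. -/
lemma sum_by_parts_sq (T p : ℕ → ℝ) (x y : ℝ) (m : ℕ) :
    T 0 * (x + y - p 0) ^ 2 + ∑ i ∈ Finset.range m, (T (i + 1) - T i) * (x + y - p (i + 1)) ^ 2 =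
      T 0 * (x - p 0) ^ 2 + ∑ i ∈ Finset.range m, (T (i + 1) - T i) * (x - p (i + 1)) ^ 2 +
        2 * y * ∑ k ∈ Finset.range m, T k * (p (k + 1) - p k) +
        T m * (y ^ 2 + 2 * y * (x - p m)) := by
  induction m with
  | zero => simp; ring
  | succ m ih =>
    simp only [Finset.sum_range_succ]
    linear_combination ih

/-- A kernel whose rows are nonnegative and nondecreasing, with first column and row increments
nonincreasing in the row index, has a nonnegative quadratic form. -/
lemma quadratic_form_nonneg_of_row_increments (S : ℕ → ℕ → ℝ) (v : ℕ → ℝ)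
    (hcol : ∀ n, S (n + 1) 0 ≤ S n 0) (hcol0 : ∀ n, 0 ≤ S n 0)
    (hinc : ∀ n i, i < n → S (n + 1) (i + 1) - S (n + 1) i ≤ S n (i + 1) - S n i)
    (hrow : ∀ n i, i < n → S n i ≤ S n (i + 1)) (N : ℕ) :
    0 ≤ ∑ n ∈ Finset.range N,
      (2 * v n * ∑ k ∈ Finset.range n, S n k * v k + S n n * v n ^ 2) := by
  set p : ℕ → ℝ := fun n => ∑ l ∈ Finset.range n, v l with hp
  have hps : ∀ n, p (n + 1) = p n + v n := fun n => Finset.sum_range_succ v n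
  have key : ∀ n, S n 0 * (p (n + 1) - p 0) ^ 2 +
      ∑ i ∈ Finset.range n, (S n (i + 1) - S n i) * (p (n + 1) - p (i + 1)) ^ 2 ≤
      ∑ n ∈ Finset.range (n + 1),
        (2 * v n * ∑ k ∈ Finset.range n, S n k * v k + S n n * v n ^ 2) := by
    intro n
    induction n with
    | zero => simp [hp]
    | succ n ih =>
      rw [Finset.sum_range_succ _ (n + 1), hps (n + 1),
        sum_by_parts_sq (S (n + 1)) p (p (n + 1)) (v (n + 1)) (n + 1),
        Finset.sum_range_succ (fun i => (S (n + 1) (i + 1) - S (n + 1) i) * _)]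
      have e : ∀ k, p (k + 1) - p k = v k := fun k => by rw [hps]; ring
      simp only [e]
      have h0 := mul_le_mul_of_nonneg_right (hcol n) (sq_nonneg (p (n + 1) - p 0))
      have h1 : ∑ i ∈ Finset.range n,
          (S (n + 1) (i + 1) - S (n + 1) i) * (p (n + 1) - p (i + 1)) ^ 2 ≤
          ∑ i ∈ Finset.range n, (S n (i + 1) - S n i) * (p (n + 1) - p (i + 1)) ^ 2 :=
        Finset.sum_le_sum fun i hi =>
          mul_le_mul_of_nonneg_right (hinc n i (Finset.mem_range.1 hi)) (sq_nonneg _)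
      linarith
  cases N with
  | zero => simp
  | succ n =>
    refine le_trans ?_ (key n)
    exact add_nonneg (mul_nonneg (hcol0 n) (sq_nonneg _)) (Finset.sum_nonneg fun i hi =>
      mul_nonneg (sub_nonneg.2 (hrow n i (Finset.mem_range.1 hi))) (sq_nonneg _))

/-- The symmetrization of the kernel of the quadratic form, indexed from `0`. -/
noncomputable def symKernel (α : ℝ) (n k : ℕ) : ℝ :=
  if k = n then 2 * cC α (n + 1) 0 else cC α (n + 1) (n - k)

lemma symKernel_zero_zero (α : ℝ) : symKernel α 0 0 = 2 * aC α 0 := by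
  simp [symKernel, cC]

lemma symKernel_succ_zero (α : ℝ) (n : ℕ) :
    symKernel α (n + 1) 0 = aC α (n + 1) - bC α (n + 1) := by
  simp [symKernel, cC]

lemma symKernel_succ_succ_self (α : ℝ) (n : ℕ) :
    symKernel α (n + 1) (n + 1) = 2 * (aC α 0 + bC α 1) := by
  simp [symKernel, cC]

lemma symKernel_add (α : ℝ) (i j : ℕ) :
    symKernel α (i + j + 2) (i + 1) = aC α (j + 1) + bC α (j + 2) - bC α (j + 1) := by
  have h : i + j + 2 - (i + 1) = j + 1 := by omega
  simp only [symKernel, cC, h]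
  rw [if_neg (by omega), if_neg (by omega), if_neg (by omega), if_neg (by omega)]

/-- Lemma 4: nonnegativity of the quadratic form
`∑_{n=1}^{N} ∑_{k=1}^{n} c_{n-k}^{(n,α)} v_k v_n`. -/
theorem cC_quadratic_form_nonneg (α : ℝ) (hα0 : 0 < α) (hα1 : α < 1)
    (N : ℕ) (hN : 1 ≤ N) (v : ℕ → ℝ) :
    0 ≤ ∑ n ∈ Finset.Icc 1 N, ∑ k ∈ Finset.Icc 1 n, cC α n (n - k) * v k * v n := by
  have b0 : ∀ k, 0 ≤ bC α (k + 1) := fun k => by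
    have := shiftSum_bC_nonneg nonnegOnNegPowers_id hα0 hα1 (Nat.le_add_left 1 k)
    linarith
  have b1 : ∀ k, bC α (k + 2) ≤ bC α (k + 1) := fun k => by
    have : 0 ≤ _ * bC α (k + 1) + _ * bC α (k + 2) + _ * bC α (k + 3) :=
      shiftSum_bC_nonneg nonnegOnNegPowers_diff hα0 hα1 (Nat.le_add_left 1 k)
    linarith
  have b2 : ∀ k, 0 ≤ 1 * bC α (k + 1) + -2 * bC α (k + 2) + 1 * bC α (k + 3) := fun k =>
    shiftSum_bC_nonneg nonnegOnNegPowers_secondDiff hα0 hα1 (Nat.le_add_left 1 k)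
  have d0 : ∀ k, 0 ≤ aC α (k + 1) - bC α (k + 1) := fun k => by
    have := shiftSum_aC_sub_bC_nonneg nonnegOnNegPowers_id hα0 hα1 (Nat.le_add_left 1 k)
    linarith
  have d1 : ∀ k, aC α (k + 2) - bC α (k + 2) ≤ aC α (k + 1) - bC α (k + 1) := fun k => by
    have : 0 ≤ _ * (aC α (k + 1) - bC α (k + 1)) + _ * (aC α (k + 2) - bC α (k + 2)) +
        _ * (aC α (k + 3) - bC α (k + 3)) :=
      shiftSum_aC_sub_bC_nonneg nonnegOnNegPowers_diff hα0 hα1 (Nat.le_add_left 1 k)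
    linarith
  have d2 : ∀ k, 0 ≤ 1 * (aC α (k + 1) - bC α (k + 1)) + -2 * (aC α (k + 2) - bC α (k + 2)) +
      1 * (aC α (k + 3) - bC α (k + 3)) := fun k =>
    shiftSum_aC_sub_bC_nonneg nonnegOnNegPowers_secondDiff hα0 hα1 (Nat.le_add_left 1 k)
  have a1 := aC_one_le hα0
  have a2 := aC_secondDiff_nonneg hα0
  have main := quadratic_form_nonneg_of_row_increments (symKernel α) (fun n => v (n + 1))
    ?_ ?_ ?_ ?_ N
  · have e : ∑ n ∈ Finset.range N, (2 * v (n + 1) *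
        ∑ k ∈ Finset.range n, symKernel α n k * v (k + 1) + symKernel α n n * v (n + 1) ^ 2) =
        2 * ∑ n ∈ Finset.Icc 1 N, ∑ k ∈ Finset.Icc 1 n, cC α n (n - k) * v k * v n := by
      rw [← Finset.Ico_add_one_right_eq_Icc, Finset.sum_Ico_eq_sum_range, Finset.mul_sum]
      refine Finset.sum_congr (by simp) fun n _ => ?_
      rw [← Finset.Ico_add_one_right_eq_Icc, Finset.sum_Ico_eq_sum_range,
        show 1 + n + 1 - 1 = n + 1 by omega, Finset.sum_range_succ, mul_add, Finset.mul_sum,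
        Finset.mul_sum]
      congr 1
      · refine Finset.sum_congr rfl fun k hk => ?_
        rw [symKernel, if_neg (Finset.mem_range.1 hk).ne, add_comm 1 n, add_comm 1 k,
          Nat.add_sub_add_right]
        ring
      · rw [symKernel, if_pos rfl, add_comm 1 n, Nat.sub_self]
        ring
    linarith
  · rintro (_ | n)
    · rw [symKernel_succ_zero, symKernel_zero_zero]
      linarith [b0 0]
    · rw [symKernel_succ_zero, symKernel_succ_zero]
      exact d1 n
  · rintro (_ | n)
    · rw [symKernel_zero_zero]
      linarith [d0 0, b0 0]
    · rw [symKernel_succ_zero]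
      exact d0 n
  · rintro n (_ | i) hi
    · obtain ⟨j, rfl⟩ := Nat.exists_eq_add_of_le' hi
      have h₁ := symKernel_add α 0 j
      rw [zero_add] at h₁
      rcases j with _ | j
      · have h₂ := symKernel_succ_succ_self α 0
        have h₃ := symKernel_succ_zero α 0
        have h₄ := symKernel_succ_zero α 1
        simp only [zero_add, Nat.reduceAdd] at *
        linarith [b0 0, b1 0, b1 1, b0 2, b0 1]
      · have h₂ := symKernel_add α 0 j
        have h₃ := symKernel_succ_zero α (j + 1)
        have h₄ := symKernel_succ_zero α (j + 2)
        simp only [zero_add, add_assoc, Nat.reduceAdd, Nat.succ_eq_add_one] at *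
        linarith [b1 (j + 1), b2 j, b2 (j + 1), d2 j, b1 j]
    · obtain ⟨j, rfl⟩ := Nat.exists_eq_add_of_le hi
      have e : i + 1 + 1 + j = i + j + 2 := by omega
      rcases j with _ | j
      · have h₁ := symKernel_add α i 0
        have h₂ := symKernel_add α i 1
        have h₃ := symKernel_add α (i + 1) 0
        have h₄ := symKernel_succ_succ_self α (i + 1)
        simp only [zero_add, add_zero, add_assoc, Nat.reduceAdd] at *
        linarith [b0 0, b1 0, b1 1, b0 2, b0 1]
      · have h₁ := symKernel_add α i (j + 1)
        have h₂ := symKernel_add α i (j + 2)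
        have h₃ := symKernel_add α (i + 1) j
        have h₄ := symKernel_add α (i + 1) (j + 1)
        rw [show i + 1 + 1 + (j + 1) = i + (j + 1) + 2 by omega]
        rw [show i + 1 + j + 2 = i + (j + 1) + 2 by omega] at h₃
        rw [show i + 1 + (j + 1) + 2 = i + (j + 1) + 2 + 1 by omega] at h₄
        rw [show i + (j + 2) + 2 = i + (j + 1) + 2 + 1 by omega] at h₂
        rw [h₁, h₂, h₃, h₄]
        simp only [add_assoc, Nat.reduceAdd] at *
        linarith [b2 (j + 1), d2 j]
  · rintro n (_ | i) hi
    · obtain ⟨j, rfl⟩ := Nat.exists_eq_add_of_le' hi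
      rw [zero_add, symKernel_succ_zero]
      rcases j with _ | j
      · have := symKernel_succ_succ_self α 0
        simp only [zero_add] at *
        linarith [b0 0]
      · have h₂ := symKernel_add α 0 j
        simp only [zero_add, add_assoc, Nat.reduceAdd] at *
        linarith [d1 j, b0 (j + 1)]
    · obtain ⟨j, rfl⟩ := Nat.exists_eq_add_of_le hi
      rcases j with _ | j
      · have h₁ := symKernel_add α i 0
        have h₄ := symKernel_succ_succ_self α (i + 1)
        simp only [zero_add, add_zero, add_assoc, Nat.reduceAdd] at *
        linarith [b0 0, b1 0]
      · have h₁ := symKernel_add α i (j + 1)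
        have h₃ := symKernel_add α (i + 1) j
        rw [show i + 1 + 1 + (j + 1) = i + (j + 1) + 2 by omega]
        rw [show i + 1 + j + 2 = i + (j + 1) + 2 by omega] at h₃
        rw [h₁, h₃]
        simp only [add_assoc, Nat.reduceAdd] at *
        linarith [b1 (j + 1), d1 j]
end

section
/- Let γ ∈ (1,2), let τ > 0, let N be a positive integer, and let T be a real number with T ≥ Nτ. Then for every real number P and all real numbers S_1, …, S_N: (τ^{1−γ}/Γ(3−γ)) Σ_{n=1}^{N} [ a_0^{(γ)} S_n − Σ_{k=1}^{n−1} (a_{n−k−1}^{(γ)} − a_{n−k}^{(γ)}) S_k − a_{n−1}^{(γ)} P ] S_n ≥ (T^{1−γ}/(2Γ(2−γ))) Σ_{n=1}^{N} S_n^2 − (T^{2−γ}/(2τΓ(3−γ))) P^2, where Γ is the Gamma function. -/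
/-- Coefficients for `γ ∈ (1,2)`: `a_k^{(γ)} = (k+1)^(2-γ) - k^(2-γ)`. -/
noncomputable def aG (γ : ℝ) (k : ℕ) : ℝ :=
  ((k : ℝ) + 1) ^ (2 - γ) - (k : ℝ) ^ (2 - γ)


lemma sum_Icc_sub_telescope (a : ℕ → ℝ) (n m : ℕ) (hm : m ≤ n) :
    ∑ k ∈ Finset.Icc 1 m, (a (n + 1 - k - 1) - a (n + 1 - k)) = a (n - m) - a n := by
  induction m with
  | zero => simp
  | succ m ih =>
    rw [Finset.sum_Icc_succ_top (by omega), ih (by omega),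
      show n + 1 - (m + 1) - 1 = n - (m + 1) by omega, show n + 1 - (m + 1) = n - m by omega]
    ring

/-- Discrete energy inequality for the L1-type convolution with an antitone nonnegative kernel. -/
lemma quadratic_form_ge_of_antitone {a : ℕ → ℝ} (ha : Antitone a) (ha0 : ∀ n, 0 ≤ a n)
    (P : ℝ) (S : ℕ → ℝ) (N : ℕ) :
    (1 / 2) * ∑ k ∈ Finset.Icc 1 N, a (N - k) * S k ^ 2
        - (1 / 2) * (∑ j ∈ Finset.range N, a j) * P ^ 2
      ≤ ∑ n ∈ Finset.Icc 1 N,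
          (a 0 * S n - (∑ k ∈ Finset.Icc 1 (n - 1), (a (n - k - 1) - a (n - k)) * S k)
            - a (n - 1) * P) * S n := by
  induction N with
  | zero => simp
  | succ n ih =>
    rw [Finset.sum_Icc_succ_top (by omega), Finset.sum_Icc_succ_top (by omega),
      Finset.sum_range_succ]
    simp only [Nat.add_sub_cancel, Nat.sub_self]
    have htel := sum_Icc_sub_telescope a n n le_rfl
    rw [Nat.sub_self] at htel
    have hcross : (∑ k ∈ Finset.Icc 1 n, (a (n + 1 - k - 1) - a (n + 1 - k)) * S k) * S (n + 1)
        ≤ (1 / 2) * (∑ k ∈ Finset.Icc 1 n, a (n - k) * S k ^ 2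
            - ∑ k ∈ Finset.Icc 1 n, a (n + 1 - k) * S k ^ 2)
          + (1 / 2) * (a 0 - a n) * S (n + 1) ^ 2 := by
      rw [← htel, ← Finset.sum_sub_distrib, Finset.sum_mul, Finset.mul_sum, Finset.mul_sum,
        Finset.sum_mul, ← Finset.sum_add_distrib]
      refine Finset.sum_le_sum fun k _ => ?_
      rw [show n + 1 - k - 1 = n - k by omega]
      have hd : 0 ≤ a (n - k) - a (n + 1 - k) := sub_nonneg.2 (ha (by omega))
      nlinarith [mul_nonneg hd (sq_nonneg (S k - S (n + 1)))]
    nlinarith [mul_nonneg (ha0 n) (sq_nonneg (P - S (n + 1)))]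

lemma aG_antitone {γ : ℝ} (hγ1 : 1 < γ) (hγ2 : γ < 2) : Antitone (aG γ) := by
  refine antitone_nat_of_succ_le fun k => ?_
  have hk : (0 : ℝ) ≤ k := k.cast_nonneg
  have h := (Real.concaveOn_rpow (p := 2 - γ) (by linarith) (by linarith)).slope_anti_adjacent
    (x := (k : ℝ)) (y := k + 1) (z := k + 1 + 1) hk (by simp only [Set.mem_Ici]; linarith)
    (by linarith) (by linarith)
  simpa [aG] using h

lemma le_aG {γ : ℝ} (hγ1 : 1 < γ) (hγ2 : γ < 2) (k : ℕ) :
    (2 - γ) * ((k : ℝ) + 1) ^ (1 - γ) ≤ aG γ k := by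
  have hk : (0 : ℝ) < (k : ℝ) + 1 := by positivity
  have hinv : ((k : ℝ) + 1)⁻¹ ≤ 1 := inv_le_one_of_one_le₀ (by simp)
  have hb := rpow_one_add_le_one_add_mul_self (s := -((k : ℝ) + 1)⁻¹) (p := 2 - γ)
    (by linarith) (by linarith) (by linarith)
  have hfac : (k : ℝ) ^ (2 - γ) =
      ((k : ℝ) + 1) ^ (2 - γ) * (1 + -((k : ℝ) + 1)⁻¹) ^ (2 - γ) := by
    rw [← Real.mul_rpow hk.le (by linarith)]
    congr 1
    field_simp
    ring
  have hexp : ((k : ℝ) + 1) ^ (1 - γ) = ((k : ℝ) + 1) ^ (2 - γ) * ((k : ℝ) + 1)⁻¹ := by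
    rw [← div_eq_mul_inv, ← Real.rpow_sub_one hk.ne']
    congr 1
    ring
  have hm := mul_le_mul_of_nonneg_left hb (Real.rpow_nonneg hk.le (2 - γ))
  rw [aG, hfac, hexp]
  linarith

lemma sum_range_aG {γ : ℝ} (hγ2 : γ < 2) (N : ℕ) :
    ∑ j ∈ Finset.range N, aG γ j = (N : ℝ) ^ (2 - γ) := by
  have h := Finset.sum_range_sub (fun j : ℕ => (j : ℝ) ^ (2 - γ)) N
  simpa [aG, Real.zero_rpow (sub_pos.2 hγ2).ne'] using h

/-- Lemma 6: coercivity of the discretized multi-term time-fractional operator of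
order `γ ∈ (1,2)`. -/
theorem aG_quadratic_form_lower_bound (γ : ℝ) (hγ1 : 1 < γ) (hγ2 : γ < 2)
    (τ : ℝ) (hτ : 0 < τ) (N : ℕ) (hN : 1 ≤ N) (T : ℝ) (hT : (N : ℝ) * τ ≤ T)
    (P : ℝ) (S : ℕ → ℝ) :
    (τ ^ (1 - γ) / Real.Gamma (3 - γ)) *
        ∑ n ∈ Finset.Icc 1 N,
          (aG γ 0 * S n
            - (∑ k ∈ Finset.Icc 1 (n - 1), (aG γ (n - k - 1) - aG γ (n - k)) * S k)
            - aG γ (n - 1) * P) * S n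
      ≥ (T ^ (1 - γ) / (2 * Real.Gamma (2 - γ))) * ∑ n ∈ Finset.Icc 1 N, (S n) ^ 2
        - (T ^ (2 - γ) / (2 * τ * Real.Gamma (3 - γ))) * P ^ 2 := by
  have hN0 : (0 : ℝ) < N := by exact_mod_cast hN
  have hT0 : 0 < T := (mul_pos hN0 hτ).trans_le hT
  have hΓ2 : 0 < Real.Gamma (2 - γ) := Real.Gamma_pos_of_pos (by linarith)
  have hΓ : Real.Gamma (3 - γ) = (2 - γ) * Real.Gamma (2 - γ) := by
    rw [← Real.Gamma_add_one (by linarith)]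
    congr 1
    ring
  have hΓ3 : 0 < Real.Gamma (3 - γ) := Real.Gamma_pos_of_pos (by linarith)
  have hanti := aG_antitone hγ1 hγ2
  have hpos : ∀ n, 0 ≤ aG γ n := fun n =>
    le_trans (mul_nonneg (by linarith) (by positivity)) (le_aG hγ1 hγ2 n)
  have hE := quadratic_form_ge_of_antitone hanti hpos P S N
  rw [sum_range_aG hγ2] at hE
  have hlow : (2 - γ) * (N : ℝ) ^ (1 - γ) * ∑ n ∈ Finset.Icc 1 N, S n ^ 2
      ≤ ∑ k ∈ Finset.Icc 1 N, aG γ (N - k) * S k ^ 2 := by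
    rw [Finset.mul_sum]
    refine Finset.sum_le_sum fun k hk => mul_le_mul_of_nonneg_right ?_ (sq_nonneg _)
    have h := le_aG hγ1 hγ2 (N - 1)
    rw [Nat.cast_sub hN, Nat.cast_one, sub_add_cancel] at h
    exact h.trans (hanti (by have := (Finset.mem_Icc.1 hk).1; omega))
  have hT1 : T ^ (1 - γ) ≤ τ ^ (1 - γ) * (N : ℝ) ^ (1 - γ) := by
    rw [mul_comm, ← Real.mul_rpow hN0.le hτ.le]
    exact Real.rpow_le_rpow_of_nonpos (mul_pos hN0 hτ) hT (by linarith)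
  have hT2 : τ ^ (1 - γ) * (N : ℝ) ^ (2 - γ) ≤ T ^ (2 - γ) / τ := by
    rw [show 1 - γ = (2 - γ) - 1 by ring, Real.rpow_sub_one hτ.ne', div_mul_eq_mul_div,
      mul_comm, ← Real.mul_rpow hN0.le hτ.le]
    gcongr
  have hS : 0 ≤ ∑ n ∈ Finset.Icc 1 N, S n ^ 2 := Finset.sum_nonneg fun _ _ => sq_nonneg _
  have hc : 0 < τ ^ (1 - γ) / Real.Gamma (3 - γ) := by positivity
  have hγ0 : 2 - γ ≠ 0 := by linarith
  refine ge_iff_le.2 (le_trans ?_ (mul_le_mul_of_nonneg_left hE hc.le))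
  calc _ ≤ τ ^ (1 - γ) * (N : ℝ) ^ (1 - γ) / (2 * Real.Gamma (2 - γ))
          * ∑ n ∈ Finset.Icc 1 N, S n ^ 2
        - τ ^ (1 - γ) * (N : ℝ) ^ (2 - γ) / (2 * Real.Gamma (3 - γ)) * P ^ 2 := by
        rw [show T ^ (2 - γ) / (2 * τ * Real.Gamma (3 - γ))
          = T ^ (2 - γ) / τ / (2 * Real.Gamma (3 - γ)) by field_simp]
        gcongr
    _ = τ ^ (1 - γ) / Real.Gamma (3 - γ) *
        ((1 / 2) * ((2 - γ) * (N : ℝ) ^ (1 - γ) * ∑ n ∈ Finset.Icc 1 N, S n ^ 2)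
          - (1 / 2) * (N : ℝ) ^ (2 - γ) * P ^ 2) := by
        rw [hΓ]
        field_simp
    _ ≤ _ := by gcongr
end

section
/- Suppose the grid functions e^0, e^1, …, e^N (each defined on {0,…,M_x}×{0,…,M_y} and vanishing for i ∈ {0, M_x} or j ∈ {0, M_y}) satisfy e^0 = 0 and the perturbed scheme: for all 1 ≤ i ≤ M_x−1, 1 ≤ j ≤ M_y−1 and 1 ≤ n ≤ N, Σ_{l=1}^{p} a_l μ_{1,l} [ a_0^{(γ_l)} ∇_t e_{ij}^n − Σ_{k=1}^{n−1} (a_{n−k−1}^{(γ_l)} − a_{n−k}^{(γ_l)}) ∇_t e_{ij}^k ] + b_1 ∇_t e_{ij}^n + Σ_{m=1}^{q} c_m μ_{2,m} Σ_{k=1}^{n} c_{n−k}^{(n,α_m)} ∇_t e_{ij}^k + b_2 e_{ij}^{n−1/2} = b_3 (δ_x^2 + δ_y^2) e_{ij}^{n−1/2} + Σ_{r=1}^{s} d_r μ_{3,r} Σ_{k=1}^{n} c_{n−k}^{(n,β_r)} ∇_t (δ_x^2 + δ_y^2) e_{ij}^k + R_{ij}^{n−1/2}, where the residuals satisfy |R_{ij}^{n−1/2}|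 ≤ ρ for all i, j, n and some ρ ≥ 0. Then b_2 ‖e^N‖_0^2 + b_3 |e^N|_1^2 ≤ ( T L_x L_y / ( Σ_{l=1}^{p} a_l T^{1−γ_l}/Γ(2−γ_l) + 2 b_1 ) ) · ρ^2. -/
/-- Discrete Laplacian `(δ_x² + δ_y²) v` at the grid point `(i, j)`. -/
noncomputable def discLap (hx hy : ℝ) (v : ℕ → ℕ → ℝ) (i j : ℕ) : ℝ :=
  (v (i - 1) j - 2 * v i j + v (i + 1) j) / hx ^ 2
    + (v i (j - 1) - 2 * v i j + v i (j + 1)) / hy ^ 2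

/-- Squared discrete `L²` norm `‖v‖₀² = hx hy ∑_{i=1}^{Mx-1} ∑_{j=1}^{My-1} v_{ij}²`. -/
noncomputable def norm0sq (hx hy : ℝ) (Mx My : ℕ) (v : ℕ → ℕ → ℝ) : ℝ :=
  hx * hy * ∑ i ∈ Finset.Icc 1 (Mx - 1), ∑ j ∈ Finset.Icc 1 (My - 1), (v i j) ^ 2

/-- Squared discrete `H¹` seminorm `|v|₁²`. -/
noncomputable def semi1sq (hx hy : ℝ) (Mx My : ℕ) (v : ℕ → ℕ → ℝ) : ℝ :=
  hx * hy *
    ((∑ i ∈ Finset.Icc 1 Mx, ∑ j ∈ Finset.Icc 1 (My - 1), ((v i j - v (i - 1) j) / hx) ^ 2)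
      + ∑ i ∈ Finset.Icc 1 (Mx - 1), ∑ j ∈ Finset.Icc 1 My, ((v i j - v i (j - 1)) / hy) ^ 2)

open Finset

/-- Abel summation bound for an antitone nonnegative weight. -/
lemma neg_mul_le_sum_antitone_mul_sub {h Z : ℕ → ℝ} (hh : Antitone h) (h0 : ∀ n, 0 ≤ h n)
    (hZ : ∀ n, 0 ≤ Z n) (N : ℕ) :
    -(h 0 * Z 0) ≤ ∑ n ∈ range N, h n * (Z (n + 1) - Z n) := by
  suffices H : h N * Z N - h 0 * Z 0 ≤ ∑ n ∈ range N, h n * (Z (n + 1) - Z n) by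
    linarith [mul_nonneg (h0 N) (hZ N)]
  induction N with
  | zero => simp
  | succ n ih =>
    rw [sum_range_succ]
    nlinarith [mul_nonneg (sub_nonneg.2 (hh n.le_succ)) (hZ (n + 1))]

/-- Coercivity of the L1-type quadratic form with antitone weights bounded below by `m`. -/
lemma mul_sum_sq_le_sum_antitone_quadratic {w : ℕ → ℝ} (hw : Antitone w) {m : ℝ}
    (y : ℕ → ℝ) {N : ℕ} (hwm : ∀ n < N, m ≤ w n) :
    m * ∑ n ∈ range N, y n ^ 2 ≤
      ∑ n ∈ range N, y n * (w 0 * y n - ∑ k ∈ range n, (w (n - k - 1) - w (n - k)) * y k) := by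
  suffices H : ∀ M ≤ N, 1 / 2 * ∑ k ∈ range M, w (M - 1 - k) * y k ^ 2
      + m / 2 * ∑ n ∈ range M, y n ^ 2 ≤
      ∑ n ∈ range M, y n * (w 0 * y n - ∑ k ∈ range n, (w (n - k - 1) - w (n - k)) * y k) by
    refine le_trans ?_ (H N le_rfl)
    have : m * ∑ n ∈ range N, y n ^ 2 ≤ ∑ k ∈ range N, w (N - 1 - k) * y k ^ 2 := by
      rw [mul_sum]
      refine sum_le_sum fun k hk => mul_le_mul_of_nonneg_right (hwm _ ?_) (sq_nonneg _)
      have := mem_range.1 hk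
      omega
    linarith
  intro M
  induction M with
  | zero => simp
  | succ n ih =>
    intro hn
    have ih := ih (by omega)
    rw [sum_range_succ (fun n => y n * _), sum_range_succ (fun k => y k ^ 2),
      sum_range_succ (fun k => w _ * y k ^ 2)]
    have hcross : y n * ∑ k ∈ range n, (w (n - k - 1) - w (n - k)) * y k ≤
        ∑ k ∈ range n, (w (n - k - 1) - w (n - k)) * ((y n ^ 2 + y k ^ 2) / 2) := by
      rw [mul_sum]
      refine sum_le_sum fun k _ => ?_
      have := hw (Nat.sub_le (n - k) 1)
      nlinarith [mul_nonneg (sub_nonneg.2 this) (sq_nonneg (y n - y k))]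
    have htel : ∑ k ∈ range n, (w (n - k - 1) - w (n - k)) = w 0 - w n := by
      have := sum_range_sub (fun k => w (n - k)) n
      simpa [Nat.sub_sub] using this
    have hsplit : ∑ k ∈ range n, (w (n - k - 1) - w (n - k)) * ((y n ^ 2 + y k ^ 2) / 2) =
        (w 0 - w n) * (y n ^ 2 / 2) + 1 / 2 * (∑ k ∈ range n, w (n - 1 - k) * y k ^ 2)
          - 1 / 2 * ∑ k ∈ range n, w (n - k) * y k ^ 2 := by
      rw [← htel, sum_mul, mul_sum, mul_sum, ← sum_add_distrib, ← sum_sub_distrib]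
      refine sum_congr rfl fun k _ => ?_
      rw [Nat.sub_right_comm n k 1]
      ring
    have hmn := mul_le_mul_of_nonneg_right (hwm n (by omega)) (sq_nonneg (y n))
    simp only [Nat.add_sub_cancel, Nat.sub_self]
    nlinarith

/-- Lower bound for the quadratic form of a convex, nonincreasing Toeplitz kernel `G`,
written for increments of the partial sums `P`. -/
lemma sum_mul_sq_sub_sq_le_sum_convex_quadratic {G : ℕ → ℝ}
    (hG : Antitone G) (hGc : Antitone fun n => G n - G (n + 1)) {P : ℕ → ℝ} (hP : P 0 = 0)
    (N : ℕ) :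
    1 / 2 * ∑ n ∈ range N, G n * (P (n + 1) ^ 2 - P n ^ 2) ≤
      ∑ n ∈ range N, (P (n + 1) - P n) * (G 0 / 2 * (P (n + 1) - P n)
        + ∑ k ∈ range n, G (n - k) * (P (k + 1) - P k)) := by
  suffices H : 1 / 2 * ∑ n ∈ range N, G n * (P (n + 1) ^ 2 - P n ^ 2)
      + 1 / 2 * ∑ k ∈ range (N - 1),
        (G (N - 1 - k - 1) - G (N - 1 - k)) * (P N - P (k + 1)) ^ 2 ≤
      ∑ n ∈ range N, (P (n + 1) - P n) * (G 0 / 2 * (P (n + 1) - P n)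
        + ∑ k ∈ range n, G (n - k) * (P (k + 1) - P k)) by
    refine le_trans (le_add_of_nonneg_right ?_) H
    refine mul_nonneg (by norm_num) (sum_nonneg fun k _ => mul_nonneg ?_ (sq_nonneg _))
    exact sub_nonneg.2 (hG (Nat.sub_le _ 1))
  induction N with
  | zero => simp
  | succ n ih =>
    rw [sum_range_succ, sum_range_succ (fun n => (P (n + 1) - P n) * _), Nat.add_sub_cancel]
    have hkey : (P (n + 1) - P n) * (G 0 / 2 * (P (n + 1) - P n)
        + ∑ k ∈ range n, G (n - k) * (P (k + 1) - P k)) =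
        1 / 2 * (G n * (P (n + 1) ^ 2 - P n ^ 2))
        + 1 / 2 * (∑ k ∈ range n, (G (n - k - 1) - G (n - k)) * (P (n + 1) - P (k + 1)) ^ 2)
        - 1 / 2 * ∑ k ∈ range n, (G (n - k - 1) - G (n - k)) * (P n - P (k + 1)) ^ 2 := by
      have htel := sum_range_sub (fun k => G (n - k) * (P (n + 1) + P n - 2 * P k)) n
      simp only [Nat.sub_self, Nat.sub_zero, hP] at htel
      have h1 : ∑ k ∈ range n, (G (n - (k + 1)) * (P (n + 1) + P n - 2 * P (k + 1))
          - G (n - k) * (P (n + 1) + P n - 2 * P k)) =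
          ∑ k ∈ range n, (G (n - k - 1) - G (n - k)) * (P (n + 1) + P n - 2 * P (k + 1))
          - 2 * ∑ k ∈ range n, G (n - k) * (P (k + 1) - P k) := by
        rw [mul_sum, ← sum_sub_distrib]
        refine sum_congr rfl fun k _ => ?_
        rw [Nat.sub_sub]
        ring
      have h2 : ∑ k ∈ range n, (G (n - k - 1) - G (n - k)) * (P (n + 1) - P (k + 1)) ^ 2
          - ∑ k ∈ range n, (G (n - k - 1) - G (n - k)) * (P n - P (k + 1)) ^ 2 =
          (P (n + 1) - P n) *
          ∑ k ∈ range n, (G (n - k - 1) - G (n - k)) * (P (n + 1) + P n - 2 * P (k + 1)) := by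
        rw [mul_sum, ← sum_sub_distrib]
        exact sum_congr rfl fun k _ => by ring
      linear_combination (-1 / 2) * h2 + (P (n + 1) - P n) / 2 * h1
        - (P (n + 1) - P n) / 2 * htel
    have hmono : ∑ k ∈ range n, (G (n - k - 1) - G (n - k)) * (P n - P (k + 1)) ^ 2 ≤
        ∑ k ∈ range (n - 1), (G (n - 1 - k - 1) - G (n - 1 - k)) * (P n - P (k + 1)) ^ 2 := by
      rcases n with _ | n
      · simp
      · rw [sum_range_succ, Nat.add_sub_cancel]
        simp only [sub_self, ne_eq, OfNat.ofNat_ne_zero, not_false_eq_true, zero_pow, mul_zero,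
          add_zero]
        refine sum_le_sum fun k hk => mul_le_mul_of_nonneg_right ?_ (sq_nonneg _)
        have hk := mem_range.1 hk
        obtain ⟨j, rfl⟩ : ∃ j, n = k + 1 + j := ⟨n - (k + 1), by omega⟩
        have := hGc j.le_succ
        have e1 : k + 1 + j + 1 - k - 1 = j + 1 := by omega
        have e2 : k + 1 + j + 1 - k = j + 2 := by omega
        have e3 : k + 1 + j - k - 1 = j := by omega
        have e4 : k + 1 + j - k = j + 1 := by omega
        rw [e1, e2, e3, e4]
        exact this
    rw [hkey]
    linarith

/-- The trapezoid rule overestimates the integral of a convex function. -/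
lemma sub_le_trapezoid_of_convexOn {F f : ℝ → ℝ} {x : ℝ}
    (hF : ∀ y ∈ Set.Icc x (x + 1), HasDerivAt F (f y) y) (hf : ConvexOn ℝ (Set.Icc x (x + 1)) f) :
    F (x + 1) - F x ≤ (f x + f (x + 1)) / 2 := by
  let ψ : ℝ → ℝ := fun t => t * f x + (f (x + 1) - f x) * t ^ 2 / 2 - F (x + t)
  have hd : ∀ t ∈ Set.Icc (0 : ℝ) 1,
      HasDerivAt ψ (f x + (f (x + 1) - f x) * t - f (x + t)) t := by
    intro t ht
    have h1 := (hF (x + t) ⟨by linarith [ht.1], by linarith [ht.2]⟩).comp_const_add x t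
    have h2 := (((hasDerivAt_id t).mul_const (f x)).add
      ((((hasDerivAt_id t).pow 2).const_mul (f (x + 1) - f x)).div_const 2)).sub h1
    exact h2.congr_deriv (by simp; ring)
  have hmono : MonotoneOn ψ (Set.Icc 0 1) := by
    refine monotoneOn_of_deriv_nonneg (convex_Icc 0 1)
      (fun t ht => (hd t ht).continuousAt.continuousWithinAt)
      (fun t ht => (hd t (interior_subset ht)).differentiableAt.differentiableWithinAt) ?_
    intro t ht
    have ht := interior_subset ht
    rw [(hd t ht).deriv]
    have := hf.2 (Set.left_mem_Icc.2 (by linarith : x ≤ x + 1)) (Set.right_mem_Icc.2 (by linarith))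
      (sub_nonneg.2 ht.2) ht.1 (by ring : (1 - t) + t = 1)
    simp only [smul_eq_mul] at this
    rw [show (1 - t) * x + t * (x + 1) = x + t by ring] at this
    linarith
  have := hmono (Set.left_mem_Icc.2 zero_le_one) (Set.right_mem_Icc.2 zero_le_one) zero_le_one
  simp only [ψ, add_zero] at this
  linarith

lemma convexOn_rpow_neg_Ioi {α : ℝ} (hα : 0 < α) :
    ConvexOn ℝ (Set.Ioi 0) fun x : ℝ => x ^ (-α) := by
  have hd : ∀ x ∈ Set.Ioi (0 : ℝ), HasDerivAt (fun x : ℝ => x ^ (-α)) (-α * x ^ (-α - 1)) x :=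
    fun x hx => Real.hasDerivAt_rpow_const (Or.inl (ne_of_gt hx))
  refine MonotoneOn.convexOn_of_deriv (convex_Ioi 0)
    (fun x hx => (hd x hx).continuousAt.continuousWithinAt) ?_ ?_
  · rw [interior_Ioi]
    exact fun x hx => (hd x hx).differentiableAt.differentiableWithinAt
  · rw [interior_Ioi]
    intro x hx y hy hxy
    rw [(hd x hx).deriv, (hd y hy).deriv]
    have := Real.rpow_le_rpow_of_nonpos hx hxy (by linarith : -α - 1 ≤ 0)
    nlinarith

/-- First difference of the primitive `x ^ (1 - α)` of `(1 - α) x ^ (-α)`. -/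
noncomputable def incr (α x : ℝ) : ℝ := (x + 1) ^ (1 - α) - x ^ (1 - α)

/-- Error of the trapezoid rule for `s ^ (1 - α)` on `[x, x + 1]`. -/
noncomputable def trapErr (α x : ℝ) : ℝ :=
  1 / (2 - α) * ((x + 1) ^ (2 - α) - x ^ (2 - α)) - 1 / 2 * ((x + 1) ^ (1 - α) + x ^ (1 - α))

lemma hasDerivAt_rpow_one_sub {α x : ℝ} (hx : 0 < x) :
    HasDerivAt (fun x : ℝ => x ^ (1 - α)) ((1 - α) * x ^ (-α)) x :=
  (Real.hasDerivAt_rpow_const (p := 1 - α) (Or.inl hx.ne')).congr_deriv (by ring_nf)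

lemma hasDerivAt_incr {α x : ℝ} (hx : 0 < x) :
    HasDerivAt (incr α) ((1 - α) * (x + 1) ^ (-α) - (1 - α) * x ^ (-α)) x :=
  ((hasDerivAt_rpow_one_sub (by linarith : 0 < x + 1)).comp_add_const x 1).sub
    (hasDerivAt_rpow_one_sub hx)

lemma hasDerivAt_rpow_two_sub {α x : ℝ} (h1 : α < 1) (hx : 0 < x) :
    HasDerivAt (fun x : ℝ => 1 / (2 - α) * x ^ (2 - α)) (x ^ (1 - α)) x := by
  refine ((Real.hasDerivAt_rpow_const (p := 2 - α) (Or.inl hx.ne')).const_mul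
    (1 / (2 - α))).congr_deriv ?_
  have : 2 - α ≠ 0 := by linarith
  rw [show 2 - α - 1 = 1 - α by ring]
  field_simp

lemma hasDerivAt_trapErr {α x : ℝ} (h1 : α < 1) (hx : 0 < x) :
    HasDerivAt (trapErr α)
      (incr α x - 1 / 2 * ((1 - α) * (x + 1) ^ (-α) + (1 - α) * x ^ (-α))) x := by
  have hx1 : 0 < x + 1 := by linarith
  have hF := ((hasDerivAt_rpow_two_sub h1 hx1).comp_add_const x 1).sub
    (hasDerivAt_rpow_two_sub h1 hx)
  have hf := (((hasDerivAt_rpow_one_sub (α := α) hx1).comp_add_const x 1).add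
    (hasDerivAt_rpow_one_sub (α := α) hx)).const_mul (1 / 2)
  refine (hF.sub hf).congr_of_eventuallyEq (Filter.Eventually.of_forall fun y => ?_)
  simp only [trapErr, Pi.sub_apply, Pi.add_apply]
  ring

lemma antitoneOn_Ioi_of_hasDerivAt {f f' : ℝ → ℝ}
    (hf : ∀ x, 0 < x → HasDerivAt f (f' x) x) (hf' : ∀ x, 0 < x → f' x ≤ 0) :
    AntitoneOn f (Set.Ioi 0) := by
  refine antitoneOn_of_deriv_nonpos (convex_Ioi 0)
    (fun x hx => (hf x hx).continuousAt.continuousWithinAt) ?_ ?_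
  · rw [interior_Ioi]
    exact fun x hx => (hf x hx).differentiableAt.differentiableWithinAt
  · rw [interior_Ioi]
    intro x hx
    rw [(hf x hx).deriv]
    exact hf' x hx

lemma rpow_neg_add_one_le {α x : ℝ} (h0 : 0 < α) (hx : 0 < x) :
    (x + 1) ^ (-α) ≤ x ^ (-α) :=
  Real.rpow_le_rpow_of_nonpos hx (by linarith) (by linarith)

lemma incr_le {α x : ℝ} (h0 : 0 < α) (h1 : α < 1) (hx : 0 < x) :
    incr α x ≤ 1 / 2 * ((1 - α) * (x + 1) ^ (-α) + (1 - α) * x ^ (-α)) := by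
  have := sub_le_trapezoid_of_convexOn (F := fun x : ℝ => x ^ (1 - α))
    (f := fun x => (1 - α) * x ^ (-α)) (x := x)
    (fun y hy => hasDerivAt_rpow_one_sub (lt_of_lt_of_le hx hy.1))
    (((convexOn_rpow_neg_Ioi h0).smul (by linarith : 0 ≤ 1 - α)).subset
      (fun y hy => lt_of_lt_of_le hx hy.1) (convex_Icc _ _))
  simp only [incr]
  linarith

lemma le_incr {α x : ℝ} (h0 : 0 < α) (h1 : α < 1) (hx : 0 < x) :
    (1 - α) * (x + 1) ^ (-α) ≤ incr α x := by
  obtain ⟨c, hc, h⟩ := exists_hasDerivAt_eq_slope (fun x : ℝ => x ^ (1 - α))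
    (fun x => (1 - α) * x ^ (-α)) (by linarith : x < x + 1)
    (fun y hy => (hasDerivAt_rpow_one_sub
      (lt_of_lt_of_le hx hy.1)).continuousAt.continuousWithinAt)
    (fun y hy => hasDerivAt_rpow_one_sub (hx.trans hy.1))
  have hle := Real.rpow_le_rpow_of_nonpos (hx.trans hc.1) hc.2.le (by linarith : -α ≤ 0)
  rw [add_sub_cancel_left, div_one] at h
  rw [incr, ← h]
  exact mul_le_mul_of_nonneg_left hle (by linarith)

lemma antitoneOn_incr {α : ℝ} (h0 : 0 < α) (h1 : α < 1) :
    AntitoneOn (incr α) (Set.Ioi 0) :=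
  antitoneOn_Ioi_of_hasDerivAt (fun _ hx => hasDerivAt_incr hx) fun _ hx =>
    sub_nonpos.2 (mul_le_mul_of_nonneg_left (rpow_neg_add_one_le h0 hx) (by linarith))

lemma antitoneOn_incr_sub_incr {α : ℝ} (h0 : 0 < α) (h1 : α < 1) :
    AntitoneOn (fun x => incr α x - incr α (x + 1)) (Set.Ioi 0) := by
  refine antitoneOn_Ioi_of_hasDerivAt (fun x hx => (hasDerivAt_incr hx).sub
    ((hasDerivAt_incr (by linarith : 0 < x + 1)).comp_add_const x 1)) fun x hx => ?_
  have := (convexOn_rpow_neg_Ioi h0).2 (Set.mem_Ioi.2 hx)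
    (Set.mem_Ioi.2 (by linarith : 0 < x + 1 + 1)) (by norm_num : (0 : ℝ) ≤ 1 / 2)
    (by norm_num : (0 : ℝ) ≤ 1 / 2) (by norm_num)
  simp only [smul_eq_mul] at this
  rw [show 1 / 2 * x + 1 / 2 * (x + 1 + 1) = x + 1 by ring] at this
  nlinarith

lemma antitoneOn_trapErr {α : ℝ} (h0 : 0 < α) (h1 : α < 1) :
    AntitoneOn (trapErr α) (Set.Ioi 0) :=
  antitoneOn_Ioi_of_hasDerivAt (fun _ hx => hasDerivAt_trapErr h1 hx) fun _ hx =>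
    sub_nonpos.2 (incr_le h0 h1 hx)

lemma trapErr_nonneg {α x : ℝ} (h0 : 0 < α) (h1 : α < 1) (hx : 0 < x) :
    0 ≤ trapErr α x := by
  have := sub_le_trapezoid_of_convexOn (F := fun x : ℝ => -(1 / (2 - α) * x ^ (2 - α)))
    (f := fun x => -x ^ (1 - α)) (x := x)
    (fun y hy => (hasDerivAt_rpow_two_sub h1 (lt_of_lt_of_le hx hy.1)).neg)
    ((Real.concaveOn_rpow (by linarith) (by linarith)).neg.subset
      (fun y hy => (lt_of_lt_of_le hx hy.1).le) (convex_Icc _ _))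
  simp only [trapErr]
  linarith

lemma antitoneOn_incr_sub_trapErr {α : ℝ} (h0 : 0 < α) (h1 : α < 1) :
    AntitoneOn (fun x => incr α x - trapErr α x) (Set.Ioi 0) := by
  refine antitoneOn_Ioi_of_hasDerivAt
    (fun x hx => (hasDerivAt_incr hx).sub (hasDerivAt_trapErr h1 hx)) fun x hx => ?_
  have h2 := le_incr h0 h1 hx
  have h3 := mul_le_mul_of_nonneg_left (rpow_neg_add_one_le h0 hx) (by linarith : 0 ≤ 1 - α)
  linarith

lemma trapErr_le_incr {α x : ℝ} (h1 : α < 1) (hx : 0 < x) :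
    trapErr α x ≤ incr α x := by
  obtain ⟨c, hc, h⟩ := exists_hasDerivAt_eq_slope (fun x : ℝ => 1 / (2 - α) * x ^ (2 - α))
    (fun x => x ^ (1 - α)) (by linarith : x < x + 1)
    (fun y hy => (hasDerivAt_rpow_two_sub h1
      (lt_of_lt_of_le hx hy.1)).continuousAt.continuousWithinAt)
    (fun y hy => hasDerivAt_rpow_two_sub h1 (hx.trans hy.1))
  have hle := Real.rpow_le_rpow (hx.trans hc.1).le hc.2.le (by linarith : 0 ≤ 1 - α)
  have hle' := Real.rpow_le_rpow hx.le (by linarith : x ≤ x + 1) (by linarith : 0 ≤ 1 - α)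
  rw [add_sub_cancel_left, div_one] at h
  simp only [trapErr, incr]
  linarith

lemma three_mul_three_rpow_le_s17 {t : ℝ} (ht : t < 1) :
    3 * (3 : ℝ) ^ t ≤ 4 + 5 ^ t := by
  have key : ∀ y : ℝ, 0 < y → 1 + (1 - t) * Real.log y ≤ y ^ (1 - t) := fun y hy => by
    rw [Real.rpow_def_of_pos hy]
    linarith [Real.add_one_le_exp (Real.log y * (1 - t))]
  have h3 := key 3 (by norm_num)
  have h35 := key (3 / 5) (by norm_num)
  rw [Real.log_div (by norm_num) (by norm_num)] at h35
  have hlog : 5 * Real.log 5 ≤ 9 * Real.log 3 := by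
    have := Real.log_le_log (by norm_num) (by norm_num : (5 : ℝ) ^ 5 ≤ 3 ^ 9)
    simpa [Real.log_pow] using this
  have hu := Real.rpow_pos_of_pos (by norm_num : (0 : ℝ) < 3) t
  have hv := Real.rpow_pos_of_pos (by norm_num : (0 : ℝ) < 5) t
  rw [Real.div_rpow (by norm_num) (by norm_num), Real.rpow_sub (by norm_num),
    Real.rpow_sub (by norm_num), Real.rpow_one, Real.rpow_one] at h35
  rw [Real.rpow_sub (by norm_num), Real.rpow_one] at h3
  have h9 : 9 ≤ 4 * (3 / (3 : ℝ) ^ t) + 5 * (3 / (3 : ℝ) ^ t / (5 / 5 ^ t)) := by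
    nlinarith [mul_nonneg (sub_nonneg.2 ht.le) (sub_nonneg.2 hlog)]
  have h9' := mul_le_mul_of_nonneg_right h9 hu.le
  have : (4 * (3 / (3 : ℝ) ^ t) + 5 * (3 / (3 : ℝ) ^ t / (5 / 5 ^ t))) * 3 ^ t
      = 12 + 3 * 5 ^ t := by
    field_simp
    ring
  linarith

lemma aC_succ (α : ℝ) (k : ℕ) : aC α (k + 1) = incr α (k + 1 / 2) := by
  simp only [aC, incr, Nat.succ_ne_zero, if_false]
  push_cast
  ring_nf

lemma bC_succ (α : ℝ) (k : ℕ) : bC α (k + 1) = trapErr α (k + 1 / 2) := by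
  simp only [bC, trapErr]
  push_cast
  ring_nf

lemma half_add_le_succ (k : ℕ) : (k : ℝ) + 1 / 2 ≤ ((k + 1 : ℕ) : ℝ) + 1 / 2 := by
  push_cast
  linarith

lemma half_add_pos (k : ℕ) : (0 : ℝ) < (k : ℝ) + 1 / 2 := by positivity

/-- The convex Toeplitz kernel attached to the coefficients `aC`. -/
noncomputable def kernelG (α : ℝ) (k : ℕ) : ℝ := if k = 0 then 2 * aC α 0 else aC α k

section Coefficients

variable {α : ℝ}

lemma antitone_bC_succ (h0 : 0 < α) (h1 : α < 1) : Antitone fun k => bC α (k + 1) :=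
  antitone_nat_of_succ_le fun k => by
    simp only [bC_succ]
    exact antitoneOn_trapErr h0 h1 (half_add_pos _) (half_add_pos _) (half_add_le_succ k)

lemma bC_succ_nonneg (h0 : 0 < α) (h1 : α < 1) (k : ℕ) : 0 ≤ bC α (k + 1) := by
  rw [bC_succ]
  exact trapErr_nonneg h0 h1 (half_add_pos k)

lemma antitone_aC_sub_bC_succ (h0 : 0 < α) (h1 : α < 1) :
    Antitone fun k => aC α (k + 1) - bC α (k + 1) :=
  antitone_nat_of_succ_le fun k => by
    simp only [aC_succ, bC_succ]
    exact antitoneOn_incr_sub_trapErr h0 h1 (half_add_pos _) (half_add_pos _) (half_add_le_succ k)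

lemma bC_succ_le_aC_succ (h1 : α < 1) (k : ℕ) : bC α (k + 1) ≤ aC α (k + 1) := by
  rw [aC_succ, bC_succ]
  exact trapErr_le_incr h1 (half_add_pos k)

lemma antitone_aC_succ (h0 : 0 < α) (h1 : α < 1) : Antitone fun k => aC α (k + 1) :=
  antitone_nat_of_succ_le fun k => by
    simp only [aC_succ]
    exact antitoneOn_incr h0 h1 (half_add_pos _) (half_add_pos _) (half_add_le_succ k)

lemma two_mul_aC_one_le (h0 : 0 < α) : 2 * aC α 1 ≤ 2 * aC α 0 + aC α 2 := by
  have h := three_mul_three_rpow_le_s17 (by linarith : 1 - α < 1)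
  have e3 : (3 / 2 : ℝ) ^ (1 - α) = 3 ^ (1 - α) * (1 / 2) ^ (1 - α) := by
    rw [← Real.mul_rpow (by norm_num) (by norm_num)]; norm_num
  have e5 : (5 / 2 : ℝ) ^ (1 - α) = 5 ^ (1 - α) * (1 / 2) ^ (1 - α) := by
    rw [← Real.mul_rpow (by norm_num) (by norm_num)]; norm_num
  have hp := Real.rpow_pos_of_pos (by norm_num : (0 : ℝ) < 1 / 2) (1 - α)
  simp only [aC]
  norm_num only [e3, e5, if_true, if_false, Nat.cast_one, Nat.cast_ofNat]
  norm_num only [e3, e5, if_true, if_false, Nat.cast_one, Nat.cast_ofNat] at hp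
  nlinarith

lemma antitone_kernelG_sub (h0 : 0 < α) (h1 : α < 1) :
    Antitone fun k => kernelG α k - kernelG α (k + 1) := by
  refine antitone_nat_of_succ_le fun k => ?_
  rcases k with _ | k
  · have := two_mul_aC_one_le h0
    simp [kernelG]
    linarith
  · have := antitoneOn_incr_sub_incr h0 h1 (half_add_pos k) (half_add_pos _) (half_add_le_succ k)
    simp only [kernelG, Nat.succ_ne_zero, if_false, aC_succ]
    push_cast at this ⊢
    rw [show (k : ℝ) + 1 / 2 + 1 = k + 1 + 1 / 2 by ring,
      show (k : ℝ) + 1 + 1 / 2 + 1 = k + 2 + 1 / 2 by ring] at this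
    exact this

lemma antitone_kernelG (h0 : 0 < α) (h1 : α < 1) : Antitone (kernelG α) := by
  have hs : ∀ k, kernelG α (k + 2) ≤ kernelG α (k + 1) := fun k => by
    simp only [kernelG, Nat.succ_ne_zero, if_false]
    exact antitone_aC_succ h0 h1 k.le_succ
  refine antitone_nat_of_succ_le fun k => ?_
  rcases k with _ | k
  · have := antitone_kernelG_sub h0 h1 (Nat.zero_le 1)
    have := hs 0
    simp only at *
    linarith
  · exact hs k

/-- Nonnegativity of the discrete convolution form of the coefficients `cC`. -/
lemma sum_cC_quadratic_nonneg_range (h0 : 0 < α) (h1 : α < 1) (x : ℕ → ℝ) (N : ℕ) :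
    0 ≤ ∑ n ∈ range N, x n * ∑ k ∈ range (n + 1), cC α (n + 1) (n - k) * x k := by
  rcases N with _ | N
  · simp
  set P : ℕ → ℝ := fun n => ∑ i ∈ range n, x i with hP
  have hPx : ∀ n, P (n + 1) - P n = x n := fun n => by simp [hP, sum_range_succ]
  have hP1 : P 1 = x 0 := by simp [hP]
  -- the row at level `n + 2` splits into three parts
  have hrow : ∀ n, ∑ k ∈ range (n + 2), cC α (n + 2) (n + 1 - k) * x k =
      (kernelG α 0 / 2 * x (n + 1) + ∑ k ∈ range (n + 1), kernelG α (n + 1 - k) * x k)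
      + (bC α 1 * x (n + 1)
        - ∑ k ∈ range n, (bC α (n - k - 1 + 1) - bC α (n - k + 1)) * x (k + 1))
      - bC α (n + 1) * x 0 := by
    intro n
    rw [sum_range_succ, sum_range_succ', sum_range_succ' (fun k => kernelG _ _ * _)]
    have hmid : ∑ k ∈ range n, cC α (n + 2) (n + 1 - (k + 1)) * x (k + 1) =
        ∑ k ∈ range n, kernelG α (n + 1 - (k + 1)) * x (k + 1)
        - ∑ k ∈ range n, (bC α (n - k - 1 + 1) - bC α (n - k + 1)) * x (k + 1) := by
      rw [← sum_sub_distrib]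
      refine sum_congr rfl fun k hk => ?_
      obtain ⟨j, rfl⟩ : ∃ j, n = k + 1 + j := ⟨n - (k + 1), by have := mem_range.1 hk; omega⟩
      have e1 : k + 1 + j + 1 - (k + 1) = j + 1 := by omega
      have e2 : k + 1 + j - k = j + 1 := by omega
      rw [e1, e2]
      have e3 : ¬ (k + 1 + j + 2 ≤ 1) := by omega
      have e4 : ¬ (j + 1 = k + 1 + j + 2 - 1) := by omega
      simp only [cC, kernelG, e3, e4, if_false, Nat.succ_ne_zero, Nat.add_sub_cancel]
      ring
    rw [hmid]
    simp [cC, kernelG]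
    ring
  rw [sum_range_succ']
  have hsum : ∑ n ∈ range N, x (n + 1) *
      ∑ k ∈ range (n + 1 + 1), cC α (n + 1 + 1) (n + 1 - k) * x k =
      ∑ n ∈ range N, x (n + 1) *
        (kernelG α 0 / 2 * x (n + 1) + ∑ k ∈ range (n + 1), kernelG α (n + 1 - k) * x k)
      + ∑ n ∈ range N, x (n + 1) * (bC α 1 * x (n + 1)
        - ∑ k ∈ range n, (bC α (n - k - 1 + 1) - bC α (n - k + 1)) * x (k + 1))
      - x 0 * ∑ n ∈ range N, bC α (n + 1) * x (n + 1) := by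
    rw [mul_sum, ← sum_add_distrib, ← sum_sub_distrib]
    refine sum_congr rfl fun n _ => ?_
    rw [hrow]
    ring
  rw [hsum]
  have hA := sum_mul_sq_sub_sq_le_sum_convex_quadratic (antitone_kernelG h0 h1)
    (antitone_kernelG_sub h0 h1) (P := P) (by simp [hP]) (N + 1)
  simp only [hPx] at hA
  rw [sum_range_succ', sum_range_succ' (fun n => x n * _)] at hA
  have hB := mul_sum_sq_le_sum_antitone_quadratic (antitone_bC_succ h0 h1) (m := 0)
    (fun n => x (n + 1)) (N := N) fun n _ => bC_succ_nonneg h0 h1 n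
  have hC := neg_mul_le_sum_antitone_mul_sub (antitone_aC_sub_bC_succ h0 h1)
    (fun n => sub_nonneg.2 (bC_succ_le_aC_succ h1 n)) (Z := fun n => P (n + 1) ^ 2)
    (fun n => sq_nonneg _) N
  have hD := neg_mul_le_sum_antitone_mul_sub (antitone_bC_succ h0 h1)
    (bC_succ_nonneg h0 h1) (Z := fun n => (P (n + 1) - x 0) ^ 2) (fun n => sq_nonneg _) N
  have hE : ∑ n ∈ range N, kernelG α (n + 1) * (P (n + 1 + 1) ^ 2 - P (n + 1) ^ 2) =
      ∑ n ∈ range N, (aC α (n + 1) - bC α (n + 1)) * (P (n + 1 + 1) ^ 2 - P (n + 1) ^ 2)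
      + ∑ n ∈ range N, bC α (n + 1) * ((P (n + 1 + 1) - x 0) ^ 2 - (P (n + 1) - x 0) ^ 2)
      + 2 * (x 0 * ∑ n ∈ range N, bC α (n + 1) * x (n + 1)) := by
    rw [mul_sum, mul_sum, ← sum_add_distrib, ← sum_add_distrib]
    refine sum_congr rfl fun n _ => ?_
    rw [← hPx (n + 1)]
    simp only [kernelG, Nat.succ_ne_zero, if_false]
    ring
  have hG01 : aC α 1 - bC α 1 ≤ kernelG α 0 := by
    have h := antitone_kernelG h0 h1 (Nat.zero_le 1)
    have h' : kernelG α 1 = aC α 1 := by simp [kernelG]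
    have := bC_succ_nonneg h0 h1 0
    simp only [zero_add] at this
    linarith
  have hF := mul_le_mul_of_nonneg_right hG01 (sq_nonneg (x 0))
  have hc : cC α 1 0 = kernelG α 0 / 2 := by simp [cC, kernelG]
  have hP0 : P 0 = 0 := by simp [hP]
  simp only [zero_add, hP1, hP0, range_one, sum_singleton, range_zero, sum_empty, zero_mul,
    sub_self, Nat.sub_self, hc] at *
  nlinarith

end Coefficients

lemma sum_Icc_one_eq_sum_range {β : Type*} [AddCommMonoid β] (f : ℕ → β) (N : ℕ) :
    ∑ n ∈ Icc 1 N, f n = ∑ n ∈ range N, f (n + 1) := by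
  induction N with
  | zero => simp
  | succ n ih => rw [sum_Icc_succ_top (by omega), ih, sum_range_succ]

lemma sum_cC_quadratic_nonneg {α : ℝ} (h0 : 0 < α) (h1 : α < 1) (x : ℕ → ℝ) (N : ℕ) :
    0 ≤ ∑ n ∈ Icc 1 N, x n * ∑ k ∈ Icc 1 n, cC α n (n - k) * x k := by
  simp only [sum_Icc_one_eq_sum_range, Nat.add_sub_add_right]
  exact sum_cC_quadratic_nonneg_range h0 h1 (fun n => x (n + 1)) N

lemma antitone_aG {γ : ℝ} (h1 : 1 < γ) (h2 : γ < 2) : Antitone (aG γ) := by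
  refine antitone_nat_of_succ_le fun k => ?_
  have := (Real.concaveOn_rpow (by linarith : 0 ≤ 2 - γ) (by linarith)).2
    (Set.mem_Ici.2 (by positivity : (0 : ℝ) ≤ k)) (Set.mem_Ici.2 (by positivity : (0 : ℝ) ≤ k + 2))
    (by norm_num : (0 : ℝ) ≤ 1 / 2) (by norm_num : (0 : ℝ) ≤ 1 / 2) (by norm_num)
  simp only [smul_eq_mul] at this
  rw [show (1 / 2 : ℝ) * k + 1 / 2 * (k + 2) = k + 1 by ring] at this
  simp only [aG]
  push_cast
  rw [show (k : ℝ) + 1 + 1 = k + 2 by ring]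
  linarith

lemma mul_rpow_le_aG {γ : ℝ} (h1 : 1 < γ) (h2 : γ < 2) {k N : ℕ} (hk : k < N) :
    (2 - γ) * (N : ℝ) ^ (1 - γ) ≤ aG γ k := by
  have hk1 : (0 : ℝ) < k + 1 := by positivity
  have hkN : (k : ℝ) + 1 ≤ N := by exact_mod_cast hk
  have hle := Real.rpow_le_rpow_of_nonpos hk1 hkN (by linarith : 1 - γ ≤ 0)
  have hs : -1 ≤ -(1 / ((k : ℝ) + 1)) :=
    neg_le_neg ((div_le_one hk1).2 (by linarith [Nat.cast_nonneg (α := ℝ) k]))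
  have hB := rpow_one_add_le_one_add_mul_self hs (by linarith : 0 ≤ 2 - γ) (by linarith)
  have hk' : (k : ℝ) = (k + 1) * (1 + -(1 / ((k : ℝ) + 1))) := by field_simp; ring
  have hpow : (k : ℝ) ^ (2 - γ) =
      ((k : ℝ) + 1) ^ (2 - γ) * (1 + -(1 / ((k : ℝ) + 1))) ^ (2 - γ) := by
    rw [← Real.mul_rpow hk1.le (by linarith), ← hk']
  have hsub : ((k : ℝ) + 1) ^ (1 - γ) = ((k : ℝ) + 1) ^ (2 - γ) * (1 / ((k : ℝ) + 1)) := by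
    rw [show 1 - γ = 2 - γ - 1 by ring, Real.rpow_sub_one hk1.ne']
    ring
  have hm := mul_le_mul_of_nonneg_left hB (Real.rpow_nonneg hk1.le (2 - γ))
  have hm' := mul_le_mul_of_nonneg_left hle (by linarith : 0 ≤ 2 - γ)
  simp only [aG]
  rw [hpow]
  rw [hsub] at hm'
  linarith

lemma mul_sum_sq_le_sum_aG_quadratic {γ : ℝ} (h1 : 1 < γ) (h2 : γ < 2) (y : ℕ → ℝ) (N : ℕ) :
    (2 - γ) * (N : ℝ) ^ (1 - γ) * ∑ n ∈ Icc 1 N, y n ^ 2 ≤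
      ∑ n ∈ Icc 1 N, y n * (aG γ 0 * y n
        - ∑ k ∈ Icc 1 (n - 1), (aG γ (n - k - 1) - aG γ (n - k)) * y k) := by
  simp only [sum_Icc_one_eq_sum_range, Nat.add_sub_add_right, Nat.add_sub_cancel]
  exact mul_sum_sq_le_sum_antitone_quadratic (antitone_aG h1 h2) (fun n => y (n + 1))
    fun n hn => mul_rpow_le_aG h1 h2 hn

/-- Coercivity of the time-stepping operator at a fixed grid point. -/
lemma sum_time_operator_mul_ge {T : ℝ} (hT : 0 < T) {N : ℕ} (hN : 1 ≤ N) {τ : ℝ} (hτ : τ = T / N)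
    {p q : ℕ} {a γ c α : ℕ → ℝ} (haγ : ∀ l ∈ Icc 1 p, 0 < a l ∧ 1 < γ l ∧ γ l < 2)
    (hcα : ∀ m ∈ Icc 1 q, 0 < c m ∧ 0 < α m ∧ α m < 1) (b1 b2 : ℝ)
    {ε : ℕ → ℝ} (hε : ε 0 = 0) :
    ((∑ l ∈ Icc 1 p, a l * T ^ (1 - γ l) / Real.Gamma (2 - γ l)) + b1)
        * ∑ n ∈ Icc 1 N, ((ε n - ε (n - 1)) / τ) ^ 2 + b2 / (2 * τ) * ε N ^ 2 ≤
      ∑ n ∈ Icc 1 N, ((ε n - ε (n - 1)) / τ) *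
        ((∑ l ∈ Icc 1 p, a l * (τ ^ (1 - γ l) / Real.Gamma (3 - γ l)) *
          (aG (γ l) 0 * ((ε n - ε (n - 1)) / τ)
            - (∑ k ∈ Icc 1 (n - 1),
                (aG (γ l) (n - k - 1) - aG (γ l) (n - k)) * ((ε k - ε (k - 1)) / τ))))
        + b1 * ((ε n - ε (n - 1)) / τ)
        + (∑ m ∈ Icc 1 q, c m * (τ ^ (1 - α m) / Real.Gamma (2 - α m)) *
            ∑ k ∈ Icc 1 n, cC (α m) n (n - k) * ((ε k - ε (k - 1)) / τ))
        + b2 * ((ε n + ε (n - 1)) / 2)) := by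
  have hN0 : (0 : ℝ) < N := by exact_mod_cast hN
  have hτ0 : 0 < τ := by rw [hτ]; positivity
  set y : ℕ → ℝ := fun n => (ε n - ε (n - 1)) / τ with hy
  have htel : ∑ n ∈ Icc 1 N, y n * (b2 * ((ε n + ε (n - 1)) / 2)) = b2 / (2 * τ) * ε N ^ 2 := by
    have h := sum_range_sub (fun n => b2 / (2 * τ) * ε n ^ 2) N
    rw [hε] at h
    rw [sum_Icc_one_eq_sum_range]
    refine (sum_congr rfl fun n _ => ?_).trans (h.trans (by ring))
    simp only [hy, Nat.add_sub_cancel]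
    field_simp
    ring
  have hα : 0 ≤ ∑ n ∈ Icc 1 N, y n *
      ∑ m ∈ Icc 1 q, c m * (τ ^ (1 - α m) / Real.Gamma (2 - α m)) *
        ∑ k ∈ Icc 1 n, cC (α m) n (n - k) * y k := by
    simp only [mul_sum (Icc 1 q)]
    rw [sum_comm]
    refine sum_nonneg fun m hm => ?_
    obtain ⟨hc, h0, h1⟩ := hcα m hm
    have hΓ := Real.Gamma_pos_of_pos (by linarith : 0 < 2 - α m)
    simp only [mul_left_comm (y _)]
    rw [← mul_sum]
    exact mul_nonneg (by positivity) (sum_cC_quadratic_nonneg h0 h1 y N)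
  have hγ : (∑ l ∈ Icc 1 p, a l * T ^ (1 - γ l) / Real.Gamma (2 - γ l)) * ∑ n ∈ Icc 1 N, y n ^ 2 ≤
      ∑ n ∈ Icc 1 N, y n * ∑ l ∈ Icc 1 p, a l * (τ ^ (1 - γ l) / Real.Gamma (3 - γ l)) *
          (aG (γ l) 0 * y n
            - (∑ k ∈ Icc 1 (n - 1), (aG (γ l) (n - k - 1) - aG (γ l) (n - k)) * y k)) := by
    simp only [mul_sum (Icc 1 p)]
    rw [sum_comm, sum_mul]
    refine sum_le_sum fun l hl => ?_
    obtain ⟨ha, h1, h2⟩ := haγ l hl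
    have hΓ := Real.Gamma_pos_of_pos (by linarith : 0 < 2 - γ l)
    have hΓ' : Real.Gamma (3 - γ l) = (2 - γ l) * Real.Gamma (2 - γ l) := by
      rw [← Real.Gamma_add_one (by linarith)]; ring_nf
    have h2' : 0 < 2 - γ l := by linarith
    have hT' : T ^ (1 - γ l) = τ ^ (1 - γ l) * (N : ℝ) ^ (1 - γ l) := by
      rw [← Real.mul_rpow hτ0.le hN0.le, hτ, div_mul_cancel₀ _ hN0.ne']
    have h := mul_le_mul_of_nonneg_left (mul_sum_sq_le_sum_aG_quadratic h1 h2 y N)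
      (by rw [hΓ']; positivity : 0 ≤ a l * (τ ^ (1 - γ l) / Real.Gamma (3 - γ l)))
    simp only [mul_left_comm (y _)]
    rw [← mul_sum]
    refine le_trans (le_of_eq ?_) h
    rw [hΓ', hT']
    field_simp
  have hb : b1 * ∑ n ∈ Icc 1 N, y n ^ 2 = ∑ n ∈ Icc 1 N, y n * (b1 * y n) := by
    rw [mul_sum]
    exact sum_congr rfl fun n _ => by ring
  simp only [mul_add, sum_add_distrib, add_mul] at hb htel ⊢
  linarith

lemma sum_second_diff_mul {M : ℕ} (hM : 1 ≤ M) (u : ℕ → ℝ) {v : ℕ → ℝ} (hv0 : v 0 = 0)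
    (hvM : v M = 0) :
    ∑ i ∈ Icc 1 (M - 1), (u (i - 1) - 2 * u i + u (i + 1)) * v i =
      -∑ i ∈ Icc 1 M, (u i - u (i - 1)) * (v i - v (i - 1)) := by
  obtain ⟨m, rfl⟩ : ∃ m, M = m + 1 := ⟨M - 1, by omega⟩
  simp only [sum_Icc_one_eq_sum_range, Nat.add_sub_cancel]
  have H : ∀ m, ∑ i ∈ range m, (u i - 2 * u (i + 1) + u (i + 1 + 1)) * v (i + 1) =
      -∑ i ∈ range (m + 1), (u (i + 1) - u i) * (v (i + 1) - v i)
        + (u (m + 1) - u m) * v (m + 1) := by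
    intro m
    induction m with
    | zero => simp [hv0]
    | succ m ih =>
      rw [sum_range_succ, ih, sum_range_succ _ (m + 1)]
      ring
  rw [H, hvM]
  ring

/-- The bilinear form polarizing `semi1sq`, without the weight `hx * hy`. -/
noncomputable def gradForm (hx hy : ℝ) (Mx My : ℕ) (u v : ℕ → ℕ → ℝ) : ℝ :=
  (∑ i ∈ Icc 1 Mx, ∑ j ∈ Icc 1 (My - 1),
      ((u i j - u (i - 1) j) / hx) * ((v i j - v (i - 1) j) / hx))
    + ∑ i ∈ Icc 1 (Mx - 1), ∑ j ∈ Icc 1 My,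
      ((u i j - u i (j - 1)) / hy) * ((v i j - v i (j - 1)) / hy)

/-- Summation by parts for the discrete Laplacian. -/
lemma sum_discLap_mul (hx hy : ℝ) {Mx My : ℕ} (hMx : 1 ≤ Mx) (hMy : 1 ≤ My) (u : ℕ → ℕ → ℝ)
    {v : ℕ → ℕ → ℝ} (hv : ∀ i j, (i = 0 ∨ i = Mx ∨ j = 0 ∨ j = My) → v i j = 0) :
    ∑ i ∈ Icc 1 (Mx - 1), ∑ j ∈ Icc 1 (My - 1), v i j * discLap hx hy u i j =
      -gradForm hx hy Mx My u v := by
  have hX : ∑ i ∈ Icc 1 (Mx - 1), ∑ j ∈ Icc 1 (My - 1),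
      (u (i - 1) j - 2 * u i j + u (i + 1) j) * v i j / hx ^ 2 =
      -∑ i ∈ Icc 1 Mx, ∑ j ∈ Icc 1 (My - 1),
        ((u i j - u (i - 1) j) / hx) * ((v i j - v (i - 1) j) / hx) := by
    rw [sum_comm, sum_comm (s := Icc 1 Mx), ← sum_neg_distrib]
    refine sum_congr rfl fun j _ => ?_
    have := sum_second_diff_mul hMx (fun i => u i j) (v := fun i => v i j)
      (hv _ _ (by simp)) (hv _ _ (by simp))
    rw [← sum_div, this, neg_div, sum_div]
    exact congrArg _ (sum_congr rfl fun i _ => by ring)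
  have hY : ∑ i ∈ Icc 1 (Mx - 1), ∑ j ∈ Icc 1 (My - 1),
      (u i (j - 1) - 2 * u i j + u i (j + 1)) * v i j / hy ^ 2 =
      -∑ i ∈ Icc 1 (Mx - 1), ∑ j ∈ Icc 1 My,
        ((u i j - u i (j - 1)) / hy) * ((v i j - v i (j - 1)) / hy) := by
    rw [← sum_neg_distrib]
    refine sum_congr rfl fun i _ => ?_
    have := sum_second_diff_mul hMy (u i) (v := v i) (hv _ _ (by simp)) (hv _ _ (by simp))
    rw [← sum_div, this, neg_div, sum_div]
    exact congrArg _ (sum_congr rfl fun i _ => by ring)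
  rw [gradForm, neg_add, ← hX, ← hY, ← sum_add_distrib]
  refine sum_congr rfl fun i _ => ?_
  rw [← sum_add_distrib]
  refine sum_congr rfl fun j _ => ?_
  rw [discLap]
  ring

lemma hx_mul_hy_mul_gradForm_self (hx hy : ℝ) (Mx My : ℕ) (v : ℕ → ℕ → ℝ) :
    hx * hy * gradForm hx hy Mx My v v = semi1sq hx hy Mx My v := by
  simp only [gradForm, semi1sq, sq]

lemma gradForm_avg_increment (hx hy τ : ℝ) (Mx My : ℕ) (u v : ℕ → ℕ → ℝ) :
    gradForm hx hy Mx My (fun i j => (u i j + v i j) / 2) (fun i j => (u i j - v i j) / τ) =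
      1 / (2 * τ) * gradForm hx hy Mx My u u - 1 / (2 * τ) * gradForm hx hy Mx My v v := by
  simp only [gradForm, mul_add, mul_sum]
  rw [add_sub_add_comm]
  simp only [← sum_sub_distrib]
  congr 1 <;> exact sum_congr rfl fun i _ => sum_congr rfl fun j _ => by ring

/-- Nonnegativity of the `cC` convolution, summed over a family of sequences. -/
lemma sum_cC_mul_sum_nonneg {ι : Type*} (S : Finset ι) {β : ℝ} (h0 : 0 < β) (h1 : β < 1)
    (z : ι → ℕ → ℝ) (N : ℕ) :
    0 ≤ ∑ n ∈ Icc 1 N, ∑ k ∈ Icc 1 n, cC β n (n - k) * ∑ s ∈ S, z s k * z s n := by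
  have : ∑ n ∈ Icc 1 N, ∑ k ∈ Icc 1 n, cC β n (n - k) * ∑ s ∈ S, z s k * z s n =
      ∑ s ∈ S, ∑ n ∈ Icc 1 N, z s n * ∑ k ∈ Icc 1 n, cC β n (n - k) * z s k := by
    rw [sum_comm (s := S)]
    refine sum_congr rfl fun n _ => ?_
    simp only [mul_sum]
    rw [sum_comm (s := S)]
    exact sum_congr rfl fun k _ => sum_congr rfl fun s _ => by ring
  rw [this]
  exact sum_nonneg fun s _ => sum_cC_quadratic_nonneg h0 h1 (z s) N

lemma sum_cC_mul_gradForm_nonneg (hx hy : ℝ) (Mx My : ℕ) {β : ℝ} (h0 : 0 < β) (h1 : β < 1)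
    (D : ℕ → ℕ → ℕ → ℝ) (N : ℕ) :
    0 ≤ ∑ n ∈ Icc 1 N, ∑ k ∈ Icc 1 n, cC β n (n - k) * gradForm hx hy Mx My (D k) (D n) := by
  have hX := sum_cC_mul_sum_nonneg (Icc 1 Mx ×ˢ Icc 1 (My - 1)) h0 h1
    (fun s k => (D k s.1 s.2 - D k (s.1 - 1) s.2) / hx) N
  have hY := sum_cC_mul_sum_nonneg (Icc 1 (Mx - 1) ×ˢ Icc 1 My) h0 h1
    (fun s k => (D k s.1 s.2 - D k s.1 (s.2 - 1)) / hy) N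
  simp only [sum_product] at hX hY
  simp only [gradForm, mul_add, sum_add_distrib]
  exact add_nonneg hX hY

/-- Dissipativity of the spatial operator tested against the time increments. -/
lemma sum_space_operator_mul_le {hx hy τ : ℝ} (hτ : 0 < τ) {Mx My N s : ℕ} (hMx : 1 ≤ Mx)
    (hMy : 1 ≤ My) (b3 : ℝ) {d β : ℕ → ℝ} (hdβ : ∀ r ∈ Icc 1 s, 0 < d r ∧ 0 < β r ∧ β r < 1)
    {e : ℕ → ℕ → ℕ → ℝ} (he0 : ∀ i j : ℕ, e 0 i j = 0)
    (hbd : ∀ n ≤ N, ∀ i j : ℕ, (i = 0 ∨ i = Mx ∨ j = 0 ∨ j = My) → e n i j = 0) :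
    ∑ n ∈ Icc 1 N, ∑ i ∈ Icc 1 (Mx - 1), ∑ j ∈ Icc 1 (My - 1), ((e n i j - e (n - 1) i j) / τ) *
      (b3 * discLap hx hy (fun i' j' => (e n i' j' + e (n - 1) i' j') / 2) i j
        + (∑ r ∈ Icc 1 s, d r * (τ ^ (1 - β r) / Real.Gamma (2 - β r)) *
            ∑ k ∈ Icc 1 n, cC (β r) n (n - k) *
              discLap hx hy (fun i' j' => (e k i' j' - e (k - 1) i' j') / τ) i j)) ≤
      -(b3 / (2 * τ) * gradForm hx hy Mx My (e N) (e N)) := by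
  set D : ℕ → ℕ → ℕ → ℝ := fun n i j => (e n i j - e (n - 1) i j) / τ with hD
  have hDbd : ∀ n ∈ Icc 1 N, ∀ i j, (i = 0 ∨ i = Mx ∨ j = 0 ∨ j = My) → D n i j = 0 := by
    intro n hn i j hij
    have hn := mem_Icc.1 hn
    simp [hD, hbd n hn.2 i j hij, hbd (n - 1) (by omega) i j hij]
  have hstep : ∀ n ∈ Icc 1 N, ∑ i ∈ Icc 1 (Mx - 1), ∑ j ∈ Icc 1 (My - 1), D n i j *
      (b3 * discLap hx hy (fun i' j' => (e n i' j' + e (n - 1) i' j') / 2) i j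
        + (∑ r ∈ Icc 1 s, d r * (τ ^ (1 - β r) / Real.Gamma (2 - β r)) *
            ∑ k ∈ Icc 1 n, cC (β r) n (n - k) * discLap hx hy (D k) i j)) =
      -(b3 / (2 * τ) * gradForm hx hy Mx My (e n) (e n)
        - b3 / (2 * τ) * gradForm hx hy Mx My (e (n - 1)) (e (n - 1)))
      - ∑ r ∈ Icc 1 s, d r * (τ ^ (1 - β r) / Real.Gamma (2 - β r)) *
          ∑ k ∈ Icc 1 n, cC (β r) n (n - k) * gradForm hx hy Mx My (D k) (D n) := by
    intro n hn
    have h1 := sum_discLap_mul hx hy hMx hMy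
      (fun i' j' => (e n i' j' + e (n - 1) i' j') / 2) (hDbd n hn)
    rw [gradForm_avg_increment] at h1
    have h2 : ∀ k, gradForm hx hy Mx My (D k) (D n) =
        -∑ i ∈ Icc 1 (Mx - 1), ∑ j ∈ Icc 1 (My - 1), D n i j * discLap hx hy (D k) i j :=
      fun k => by rw [sum_discLap_mul hx hy hMx hMy (D k) (hDbd n hn), neg_neg]
    have h3 : ∑ r ∈ Icc 1 s, d r * (τ ^ (1 - β r) / Real.Gamma (2 - β r)) *
          ∑ k ∈ Icc 1 n, cC (β r) n (n - k) * gradForm hx hy Mx My (D k) (D n) =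
        -∑ i ∈ Icc 1 (Mx - 1), ∑ j ∈ Icc 1 (My - 1), D n i j *
          ∑ r ∈ Icc 1 s, d r * (τ ^ (1 - β r) / Real.Gamma (2 - β r)) *
            ∑ k ∈ Icc 1 n, cC (β r) n (n - k) * discLap hx hy (D k) i j := by
      simp only [h2, mul_sum, mul_neg, sum_neg_distrib]
      congr 1
      refine Eq.symm ((sum_congr rfl fun i _ => sum_comm).trans (sum_comm.trans
        (sum_congr rfl fun r _ => (sum_congr rfl fun i _ => sum_comm).trans (sum_comm.trans
          (sum_congr rfl fun k _ => sum_congr rfl fun i _ => sum_congr rfl fun j _ => ?_)))))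
      ring
    rw [h3]
    simp only [mul_add, sum_add_distrib, mul_left_comm (D n _ _) b3]
    simp only [← mul_sum, h1]
    ring
  rw [sum_congr rfl hstep, sum_sub_distrib, sum_neg_distrib]
  have htel : ∑ n ∈ Icc 1 N, (b3 / (2 * τ) * gradForm hx hy Mx My (e n) (e n)
        - b3 / (2 * τ) * gradForm hx hy Mx My (e (n - 1)) (e (n - 1))) =
      b3 / (2 * τ) * gradForm hx hy Mx My (e N) (e N) := by
    have h := sum_range_sub (fun n => b3 / (2 * τ) * gradForm hx hy Mx My (e n) (e n)) N
    have h0 : gradForm hx hy Mx My (e 0) (e 0) = 0 := by simp [gradForm, he0]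
    rw [h0, mul_zero, sub_zero] at h
    rw [sum_Icc_one_eq_sum_range]
    exact h
  have hpos : 0 ≤ ∑ n ∈ Icc 1 N, ∑ r ∈ Icc 1 s, d r * (τ ^ (1 - β r) / Real.Gamma (2 - β r)) *
      ∑ k ∈ Icc 1 n, cC (β r) n (n - k) * gradForm hx hy Mx My (D k) (D n) := by
    rw [sum_comm]
    refine sum_nonneg fun r hr => ?_
    obtain ⟨hd, h0, h1⟩ := hdβ r hr
    have hΓ := Real.Gamma_pos_of_pos (by linarith : 0 < 2 - β r)
    rw [← mul_sum]
    exact mul_nonneg (by positivity) (sum_cC_mul_gradForm_nonneg hx hy Mx My h0 h1 D N)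
  rw [htel]
  linarith

/-- Theorem 3 (convergence estimate): if the error grid functions `e^n` satisfy the
perturbed scheme with residuals bounded by `ρ` and vanish at `n = 0` and on the
boundary, then `b₂‖e^N‖₀² + b₃|e^N|₁² ≤ (T Lx Ly/(∑_l a_l T^{1-γ_l}/Γ(2-γ_l) + 2b₁)) ρ²`. -/
theorem scheme_error_estimate
    (Lx Ly T : ℝ) (hLx : 0 < Lx) (hLy : 0 < Ly) (hT : 0 < T)
    (Mx My N : ℕ) (hMx : 1 ≤ Mx) (hMy : 1 ≤ My) (hN : 1 ≤ N)
    (hx hy τ : ℝ) (hhx : hx = Lx / Mx) (hhy : hy = Ly / My) (hτ : τ = T / N)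
    (p q s : ℕ) (hp : 1 ≤ p) (hq : 1 ≤ q) (hs : 1 ≤ s)
    (a γ : ℕ → ℝ) (haγ : ∀ l ∈ Finset.Icc 1 p, 0 < a l ∧ 1 < γ l ∧ γ l < 2)
    (b1 b2 b3 : ℝ) (hb1 : 0 < b1) (hb2 : 0 < b2) (hb3 : 0 < b3)
    (c α : ℕ → ℝ) (hcα : ∀ m ∈ Finset.Icc 1 q, 0 < c m ∧ 0 < α m ∧ α m < 1)
    (d β : ℕ → ℝ) (hdβ : ∀ r ∈ Finset.Icc 1 s, 0 < d r ∧ 0 < β r ∧ β r < 1)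
    (e : ℕ → ℕ → ℕ → ℝ) (R : ℕ → ℕ → ℕ → ℝ) (ρ : ℝ) (hρ : 0 ≤ ρ)
    (he0 : ∀ i j : ℕ, e 0 i j = 0)
    (hbd : ∀ n ≤ N, ∀ i j : ℕ, (i = 0 ∨ i = Mx ∨ j = 0 ∨ j = My) → e n i j = 0)
    (hR : ∀ n ∈ Finset.Icc 1 N, ∀ i ∈ Finset.Icc 1 (Mx - 1), ∀ j ∈ Finset.Icc 1 (My - 1),
      |R n i j| ≤ ρ)
    (hscheme : ∀ n ∈ Finset.Icc 1 N, ∀ i ∈ Finset.Icc 1 (Mx - 1), ∀ j ∈ Finset.Icc 1 (My - 1),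
      (∑ l ∈ Finset.Icc 1 p, a l * (τ ^ (1 - γ l) / Real.Gamma (3 - γ l)) *
          (aG (γ l) 0 * ((e n i j - e (n - 1) i j) / τ)
            - (∑ k ∈ Finset.Icc 1 (n - 1),
                (aG (γ l) (n - k - 1) - aG (γ l) (n - k)) * ((e k i j - e (k - 1) i j) / τ))))
        + b1 * ((e n i j - e (n - 1) i j) / τ)
        + (∑ m ∈ Finset.Icc 1 q, c m * (τ ^ (1 - α m) / Real.Gamma (2 - α m)) *
            ∑ k ∈ Finset.Icc 1 n, cC (α m) n (n - k) * ((e k i j - e (k - 1) i j) / τ))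
        + b2 * ((e n i j + e (n - 1) i j) / 2)
      = b3 * discLap hx hy (fun i' j' => (e n i' j' + e (n - 1) i' j') / 2) i j
        + (∑ r ∈ Finset.Icc 1 s, d r * (τ ^ (1 - β r) / Real.Gamma (2 - β r)) *
            ∑ k ∈ Finset.Icc 1 n, cC (β r) n (n - k) *
              discLap hx hy (fun i' j' => (e k i' j' - e (k - 1) i' j') / τ) i j)
        + R n i j) :
    b2 * norm0sq hx hy Mx My (e N) + b3 * semi1sq hx hy Mx My (e N)
      ≤ (T * Lx * Ly /
          ((∑ l ∈ Finset.Icc 1 p, a l * T ^ (1 - γ l) / Real.Gamma (2 - γ l)) + 2 * b1)) *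
          ρ ^ 2 := by
  have hN0 : (0 : ℝ) < N := by exact_mod_cast hN
  have hMx0 : (0 : ℝ) < Mx := by exact_mod_cast hMx
  have hMy0 : (0 : ℝ) < My := by exact_mod_cast hMy
  have hτ0 : 0 < τ := by rw [hτ]; positivity
  have hhx0 : 0 < hx := by rw [hhx]; positivity
  have hhy0 : 0 < hy := by rw [hhy]; positivity
  set A : ℝ := ∑ l ∈ Finset.Icc 1 p, a l * T ^ (1 - γ l) / Real.Gamma (2 - γ l) with hA
  have hA0 : 0 ≤ A := by
    refine Finset.sum_nonneg fun l hl => ?_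
    obtain ⟨ha, _, h2⟩ := haγ l hl
    have hΓ := Real.Gamma_pos_of_pos (by linarith : 0 < 2 - γ l)
    positivity
  have hK : 0 < A + b1 := by linarith
  -- pointwise in space: test the scheme with the time increment and absorb the residual
  have hpoint : ∀ i ∈ Finset.Icc 1 (Mx - 1), ∀ j ∈ Finset.Icc 1 (My - 1),
      b2 / (2 * τ) * e N i j ^ 2 - N * (ρ ^ 2 / (4 * (A + b1))) ≤
        ∑ n ∈ Finset.Icc 1 N, ((e n i j - e (n - 1) i j) / τ) *
          (b3 * discLap hx hy (fun i' j' => (e n i' j' + e (n - 1) i' j') / 2) i j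
          + (∑ r ∈ Finset.Icc 1 s, d r * (τ ^ (1 - β r) / Real.Gamma (2 - β r)) *
            ∑ k ∈ Finset.Icc 1 n, cC (β r) n (n - k) *
              discLap hx hy (fun i' j' => (e k i' j' - e (k - 1) i' j') / τ) i j)) := by
    intro i hi j hj
    have hge := sum_time_operator_mul_ge hT hN hτ haγ hcα b1 b2 (ε := fun n => e n i j) (he0 i j)
    have hle := (hge.trans_eq (Finset.sum_congr rfl fun n hn =>
      (congrArg (fun z => (e n i j - e (n - 1) i j) / τ * z) (hscheme n hn i hi j hj)).trans
        (mul_add _ _ _))).trans_eq Finset.sum_add_distrib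
    rw [← hA] at hle
    have hres : ∑ n ∈ Finset.Icc 1 N, ((e n i j - e (n - 1) i j) / τ) * R n i j ≤
        (A + b1) * ∑ n ∈ Finset.Icc 1 N, ((e n i j - e (n - 1) i j) / τ) ^ 2
          + N * (ρ ^ 2 / (4 * (A + b1))) := by
      have hconst : (N : ℝ) * (ρ ^ 2 / (4 * (A + b1))) =
          ∑ n ∈ Finset.Icc 1 N, ρ ^ 2 / (4 * (A + b1)) := by simp
      rw [hconst, Finset.mul_sum, ← Finset.sum_add_distrib]
      refine Finset.sum_le_sum fun n hn => ?_
      have hRρ : R n i j ^ 2 ≤ ρ ^ 2 := sq_le_sq' (by linarith [(abs_le.1 (hR n hn i hi j hj)).1])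
        (abs_le.1 (hR n hn i hi j hj)).2
      set y := (e n i j - e (n - 1) i j) / τ
      have h1 : y * R n i j ≤ (A + b1) * y ^ 2 + R n i j ^ 2 / (4 * (A + b1)) := by
        have h : (A + b1) * y ^ 2 + R n i j ^ 2 / (4 * (A + b1)) - y * R n i j =
            (2 * (A + b1) * y - R n i j) ^ 2 / (4 * (A + b1)) := by
          field_simp
          ring
        have : 0 ≤ (2 * (A + b1) * y - R n i j) ^ 2 / (4 * (A + b1)) := by positivity
        linarith
      have h2 : R n i j ^ 2 / (4 * (A + b1)) ≤ ρ ^ 2 / (4 * (A + b1)) := by gcongr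
      linarith
    linarith
  have hspace := sum_space_operator_mul_le (hx := hx) (hy := hy) hτ0 hMx hMy b3 hdβ he0 hbd
  rw [Finset.sum_comm, Finset.sum_congr rfl fun i _ => Finset.sum_comm] at hspace
  have hsum := (Finset.sum_le_sum fun i hi => Finset.sum_le_sum fun j hj =>
    hpoint i hi j hj).trans hspace
  simp only [Finset.sum_sub_distrib, ← Finset.mul_sum, Finset.sum_const, Nat.card_Icc,
    Nat.add_sub_cancel, nsmul_eq_mul] at hsum
  have hcells : hx * hy * (((Mx - 1 : ℕ) : ℝ) * ((My - 1 : ℕ) : ℝ)) ≤ Lx * Ly := by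
    have ex : hx * Mx = Lx := by rw [hhx]; field_simp
    have ey : hy * My = Ly := by rw [hhy]; field_simp
    have cx : ((Mx - 1 : ℕ) : ℝ) ≤ Mx := by exact_mod_cast Nat.sub_le _ _
    have cy : ((My - 1 : ℕ) : ℝ) ≤ My := by exact_mod_cast Nat.sub_le _ _
    calc hx * hy * (((Mx - 1 : ℕ) : ℝ) * ((My - 1 : ℕ) : ℝ))
        ≤ hx * hy * (Mx * My) := by gcongr
      _ = Lx * Ly := by rw [← ex, ← ey]; ring
  have hτN : τ * N = T := by rw [hτ]; field_simp
  have hscaled := mul_le_mul_of_nonneg_left hsum (by positivity : 0 ≤ hx * hy * (2 * τ))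
  rw [← hx_mul_hy_mul_gradForm_self, norm0sq]
  have hfinal : b2 * (hx * hy * ∑ i ∈ Finset.Icc 1 (Mx - 1), ∑ j ∈ Finset.Icc 1 (My - 1),
        e N i j ^ 2) + b3 * (hx * hy * gradForm hx hy Mx My (e N) (e N)) ≤
      T * (hx * hy * (((Mx - 1 : ℕ) : ℝ) * ((My - 1 : ℕ) : ℝ))) * (ρ ^ 2 / (2 * (A + b1))) := by
    rw [← hτN]
    field_simp at hscaled ⊢
    linarith
  refine hfinal.trans ?_
  calc T * (hx * hy * (((Mx - 1 : ℕ) : ℝ) * ((My - 1 : ℕ) : ℝ))) * (ρ ^ 2 / (2 * (A + b1)))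
      ≤ T * (Lx * Ly) * (ρ ^ 2 / (A + 2 * b1)) := by
        gcongr
        linarith
    _ = T * Lx * Ly / (A + 2 * b1) * ρ ^ 2 := by ring
end
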